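/- arXiv:2206.01400 — 2 statements merged into one kernel-verified Lean document; each statement's English description precedes it below -/
import Mathlib

section
/- Every heptagraph is 3-colorable, i.e., if G is a simple graph with no cycles of length less than 7 and no induced cycles of odd length at least 9, then the chromatic number of G is at most 3. -/
def IsHeptagraph {V : Type*} (G : SimpleGraph V) : Prop :=
  (∀ (v : V) (c : G.Walk v v), c.IsCycle → 7 ≤ c.length) ∧
  (∀ (v : V) (c : G.Walk v v), c.IsCycle → c.toSubgraph.IsInduced →
    Odd c.length → c.length < 9)

namespace Heptagraph

variable {V : Type*} {G : SimpleGraph V}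

/-- The vertices `g 0, …, g (N - 1)` are distinct and form a cycle of `G` in this order. -/
structure IsCyc (G : SimpleGraph V) (N : ℕ) (g : ℕ → V) : Prop where
  three_le : 3 ≤ N
  inj : ∀ i j, i < j → j < N → g i ≠ g j
  adj : ∀ i, i + 1 < N → G.Adj (g i) (g (i + 1))
  close : G.Adj (g 0) (g (N - 1))

/-- The only edges among `g 0, …, g (N - 1)` are those of the cycle. -/
def Chordless (G : SimpleGraph V) (N : ℕ) (g : ℕ → V) : Prop :=
  ∀ i j, i < j → j < N → G.Adj (g i) (g j) → j = i + 1 ∨ (i = 0 ∧ j + 1 = N)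

/-- A reformulation of `IsHeptagraph` in terms of cyclic sequences. -/
structure Hep (G : SimpleGraph V) : Prop where
  girth : ∀ N g, IsCyc G N g → 7 ≤ N
  hole : ∀ N g, IsCyc G N g → Chordless G N g → Odd N → N < 9

lemma exists_walk (g : ℕ → V) (n : ℕ) (h : ∀ i, i < n → G.Adj (g i) (g (i + 1))) :
    ∃ w : G.Walk (g n) (g 0), w.length = n ∧ w.support = ((List.range (n + 1)).reverse).map g ∧
      ∀ e, e ∈ w.edges ↔ ∃ i, i < n ∧ e = s(g i, g (i + 1)) := by
  induction n with
  | zero => exact ⟨.nil, by simp⟩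
  | succ n ih =>
    obtain ⟨w, h1, h2, h3⟩ := ih fun i hi => h i (by omega)
    refine ⟨.cons (h n (by omega)).symm w, by simp [h1], ?_, ?_⟩
    · rw [SimpleGraph.Walk.support_cons, h2]
      conv_rhs => rw [List.range_succ]
      simp
    · intro e
      rw [SimpleGraph.Walk.edges_cons, List.mem_cons, h3]
      constructor
      · rintro (rfl | ⟨i, hi, rfl⟩)
        · exact ⟨n, by omega, Sym2.eq_swap⟩
        · exact ⟨i, by omega, rfl⟩
      · rintro ⟨i, hi, rfl⟩
        rcases Nat.lt_succ_iff_lt_or_eq.1 hi with hi | rfl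
        · exact Or.inr ⟨i, hi, rfl⟩
        · exact Or.inl Sym2.eq_swap

lemma IsCyc.exists_isCycle {N : ℕ} {g : ℕ → V} (h : IsCyc G N g) :
    ∃ (v : V) (c : G.Walk v v), c.IsCycle ∧ c.length = N ∧
      (Chordless G N g → c.toSubgraph.IsInduced) := by
  obtain ⟨n, rfl⟩ : ∃ n, N = n + 3 := ⟨N - 3, by have := h.three_le; omega⟩
  obtain ⟨w, h1, h2, h3⟩ := exists_walk (G := G) g (n + 2) fun i hi => h.adj i (by omega)
  have hinj : ∀ i j, i < n + 3 → j < n + 3 → g i = g j → i = j := by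
    intro i j hi hj hij
    rcases lt_trichotomy i j with hlt | hlt | hlt
    · exact absurd hij (h.inj i j hlt hj)
    · exact hlt
    · exact absurd hij.symm (h.inj j i hlt hi)
  have hclose : G.Adj (g 0) (g (n + 2)) := h.close
  refine ⟨g 0, .cons hclose w, ?_, by simp [h1], ?_⟩
  · rw [SimpleGraph.Walk.cons_isCycle_iff]
    constructor
    · rw [SimpleGraph.Walk.isPath_def, h2]
      refine List.Nodup.map_on ?_ (List.nodup_reverse.2 List.nodup_range)
      intro x hx y hy
      simp only [List.mem_reverse, List.mem_range] at hx hy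
      exact hinj x y hx hy
    · rw [h3]
      rintro ⟨i, hi, he⟩
      rcases Sym2.eq_iff.1 he with ⟨e1, e2⟩ | ⟨e1, e2⟩
      · have := hinj _ _ (by omega) (by omega) e1
        have := hinj _ _ (by omega) (by omega) e2
        omega
      · have := hinj _ _ (by omega) (by omega) e1
        omega
  · intro hch
    have hv : ∀ x, x ∈ (SimpleGraph.Walk.cons hclose w).toSubgraph.verts →
        ∃ i, i < n + 3 ∧ g i = x := by
      intro x hx
      rw [SimpleGraph.Walk.mem_verts_toSubgraph, SimpleGraph.Walk.support_cons, h2] at hx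
      rcases List.mem_cons.1 hx with rfl | hx
      · exact ⟨0, by omega, rfl⟩
      · simp only [List.mem_map, List.mem_reverse, List.mem_range] at hx
        exact hx
    have key : ∀ i j, i < j → j < n + 3 → G.Adj (g i) (g j) →
        s(g i, g j) ∈ (SimpleGraph.Walk.cons hclose w).edges := by
      intro i j hij hj hadj
      rw [SimpleGraph.Walk.edges_cons, List.mem_cons, h3]
      rcases hch i j hij hj hadj with rfl | ⟨rfl, hj⟩
      · exact Or.inr ⟨i, by omega, rfl⟩
      · obtain rfl : j = n + 2 := by omega
        exact Or.inl rfl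
    intro x hx y hy hxy
    obtain ⟨i, hi, rfl⟩ := hv x hx
    obtain ⟨j, hj, rfl⟩ := hv y hy
    rw [SimpleGraph.Walk.adj_toSubgraph_iff_mem_edges]
    rcases lt_trichotomy i j with hlt | rfl | hlt
    · exact key i j hlt hj hxy
    · exact absurd hxy (G.loopless.irrefl _)
    · rw [Sym2.eq_swap]
      exact key j i hlt hi hxy.symm

lemma hep_of_isHeptagraph (hG : IsHeptagraph G) : Hep G where
  girth N g h := by
    obtain ⟨v, c, h1, rfl, -⟩ := h.exists_isCycle
    exact hG.1 v c h1
  hole N g h hch := by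
    obtain ⟨v, c, h1, rfl, h2⟩ := h.exists_isCycle
    exact hG.2 v c h1 (h2 hch)

lemma Hep.induce (hG : Hep G) (s : Set V) : Hep (G.induce s) := by
  have key : ∀ N g, IsCyc (G.induce s) N g → IsCyc G N fun i => (g i : V) := fun N g h =>
    ⟨h.three_le, fun i j hij hj he => h.inj i j hij hj (Subtype.ext he),
      fun i hi => h.adj i hi, h.close⟩
  exact ⟨fun N g h => hG.girth N _ (key N g h),
    fun N g h hch => hG.hole N _ (key N g h) fun i j hij hj ha => hch i j hij hj ha⟩

lemma Hep.no3 (hG : Hep G) {a b c : V} (h1 : G.Adj a b) (h2 : G.Adj b c) (h3 : G.Adj c a) :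
    False := by
  have : IsCyc G 3 fun n => if n = 0 then a else if n = 1 then b else c := by
    refine ⟨le_rfl, ?_, ?_, by simpa using h3.symm⟩
    · intro i j hij hj
      interval_cases j <;> interval_cases i <;> simp [h1.ne, h2.ne, h3.ne']
    · intro i hi
      have : i < 2 := by omega
      interval_cases i <;> simpa
  have := hG.girth _ _ this
  omega

lemma Hep.no4 (hG : Hep G) {a b c d : V} (h1 : G.Adj a b) (h2 : G.Adj b c) (h3 : G.Adj c d)
    (h4 : G.Adj d a) (hac : a ≠ c) (hbd : b ≠ d) : False := by
  have : IsCyc G 4 fun n => if n = 0 then a else if n = 1 then b else if n = 2 then c else d := by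
    refine ⟨by omega, ?_, ?_, by simpa using h4.symm⟩
    · intro i j hij hj
      interval_cases j <;> interval_cases i <;> simp [h1.ne, h2.ne, h3.ne, h4.ne', hac, hbd]
    · intro i hi
      have : i < 3 := by omega
      interval_cases i <;> simpa
  have := hG.girth _ _ this
  omega

lemma Hep.no5 (hG : Hep G) {a b c d e : V} (h1 : G.Adj a b) (h2 : G.Adj b c) (h3 : G.Adj c d)
    (h4 : G.Adj d e) (h5 : G.Adj e a) : False := by
  have ac : a ≠ c := by rintro rfl; exact hG.no3 h3 h4 h5
  have bd : b ≠ d := by rintro rfl; exact hG.no3 h4 h5 h1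
  have ce : c ≠ e := by rintro rfl; exact hG.no3 h5 h1 h2
  have da : d ≠ a := by rintro rfl; exact hG.no3 h1 h2 h3
  have eb : e ≠ b := by rintro rfl; exact hG.no3 h2 h3 h4
  have : IsCyc G 5 fun n => if n = 0 then a else if n = 1 then b else if n = 2 then c
      else if n = 3 then d else e := by
    refine ⟨by omega, ?_, ?_, by simpa using h5.symm⟩
    · intro i j hij hj
      interval_cases j <;> interval_cases i <;>
        simp [h1.ne, h2.ne, h3.ne, h4.ne, h5.ne', ac, bd, ce, da.symm, eb.symm]
    · intro i hi
      have : i < 4 := by omega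
      interval_cases i <;> simpa
  have := hG.girth _ _ this
  omega

lemma Hep.no6 (hG : Hep G) {a b c d e f : V} (h1 : G.Adj a b) (h2 : G.Adj b c) (h3 : G.Adj c d)
    (h4 : G.Adj d e) (h5 : G.Adj e f) (h6 : G.Adj f a) (ac : a ≠ c) (bd : b ≠ d) (ce : c ≠ e)
    (df : d ≠ f) (ea : e ≠ a) (fb : f ≠ b) : False := by
  have ad : a ≠ d := by rintro rfl; exact hG.no3 h1 h2 h3
  have be : b ≠ e := by rintro rfl; exact hG.no3 h2 h3 h4
  have cf : c ≠ f := by rintro rfl; exact hG.no3 h3 h4 h5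
  have : IsCyc G 6 fun n => if n = 0 then a else if n = 1 then b else if n = 2 then c
      else if n = 3 then d else if n = 4 then e else f := by
    refine ⟨by omega, ?_, ?_, by simpa using h6.symm⟩
    · intro i j hij hj
      interval_cases j <;> interval_cases i <;>
        simp [h1.ne, h2.ne, h3.ne, h4.ne, h5.ne, h6.ne', ac, bd, ce, df, ea.symm, fb.symm,
          ad, be, cf]
    · intro i hi
      have : i < 5 := by omega
      interval_cases i <;> simpa
  have := hG.girth _ _ this
  omega

lemma Hep.no9 (hG : Hep G) (v : Fin 9 → V) (hadj : ∀ i, G.Adj (v i) (v (i + 1)))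
    (hne : ∀ i, v i ≠ v (i + 2)) : False := by
  have e2 : ∀ i : Fin 9, i + 1 + 1 = i + 2 := by decide
  have e3 : ∀ i : Fin 9, i + 2 + 1 = i + 3 := by decide
  have e4 : ∀ i : Fin 9, i + 3 + 1 = i + 4 := by decide
  have e5 : ∀ i : Fin 9, i + 1 + 2 = i + 3 := by decide
  have a1 : ∀ i, G.Adj (v (i + 1)) (v (i + 2)) := fun i => by simpa [e2] using hadj (i + 1)
  have a2 : ∀ i, G.Adj (v (i + 2)) (v (i + 3)) := fun i => by simpa [e3] using hadj (i + 2)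
  have a3 : ∀ i, G.Adj (v (i + 3)) (v (i + 4)) := fun i => by simpa [e4] using hadj (i + 3)
  have n1 : ∀ i, v (i + 1) ≠ v (i + 3) := fun i => by simpa [e5] using hne (i + 1)
  have n3 : ∀ i, v i ≠ v (i + 3) := fun i he =>
    hG.no3 (hadj i) (a1 i) (by rw [he]; exact a2 i)
  have n4 : ∀ i, v i ≠ v (i + 4) := fun i he =>
    hG.no4 (hadj i) (a1 i) (a2 i) (by rw [he]; exact a3 i) (hne i) (n1 i)
  have c2 : ∀ i, ¬ G.Adj (v i) (v (i + 2)) := fun i h => hG.no3 (hadj i) (a1 i) h.symm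
  have c3 : ∀ i, ¬ G.Adj (v i) (v (i + 3)) := fun i h =>
    hG.no4 (hadj i) (a1 i) (a2 i) h.symm (hne i) (n1 i)
  have c4 : ∀ i, ¬ G.Adj (v i) (v (i + 4)) := fun i h =>
    hG.no5 (hadj i) (a1 i) (a2 i) (a3 i) h.symm
  have cases : ∀ i j : Fin 9, i ≠ j → (j = i + 1 ∨ i = j + 1) ∨ (j = i + 2 ∨ i = j + 2) ∨
      (j = i + 3 ∨ i = j + 3) ∨ (j = i + 4 ∨ i = j + 4) := by decide
  have inj : ∀ i j, i ≠ j → v i ≠ v j := by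
    intro i j hij
    rcases cases i j hij with (rfl | rfl) | (rfl | rfl) | (rfl | rfl) | (rfl | rfl)
    exacts [(hadj _).ne, (hadj _).ne', hne _, (hne _).symm, n3 _, (n3 _).symm, n4 _, (n4 _).symm]
  have chord : ∀ i j, i ≠ j → G.Adj (v i) (v j) → j = i + 1 ∨ i = j + 1 := by
    intro i j hij ha
    rcases cases i j hij with h | (rfl | rfl) | (rfl | rfl) | (rfl | rfl)
    exacts [h, (c2 _ ha).elim, (c2 _ ha.symm).elim, (c3 _ ha).elim, (c3 _ ha.symm).elim,
      (c4 _ ha).elim, (c4 _ ha.symm).elim]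
  have val : ∀ i : ℕ, i < 9 → ((Fin.ofNat 9 i : Fin 9) : ℕ) = i := fun i hi => Nat.mod_eq_of_lt hi
  have hne' : ∀ i j, i < j → j < 9 → Fin.ofNat 9 i ≠ Fin.ofNat 9 j := by
    intro i j hij hj he
    have := congrArg Fin.val he
    rw [val i (by omega), val j hj] at this
    omega
  have hs : ∀ i, Fin.ofNat 9 (i + 1) = Fin.ofNat 9 i + 1 := by
    intro i; ext; simp [Fin.val_add]
  have hcyc : IsCyc G 9 fun i => v (Fin.ofNat 9 i) := by
    refine ⟨by omega, fun i j hij hj => inj _ _ (hne' i j hij hj), fun i _ => ?_, ?_⟩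
    · simp only [hs]
      exact hadj _
    · exact (hadj 8).symm
  refine absurd (hG.hole 9 _ hcyc ?_ (by decide)) (lt_irrefl 9)
  intro i j hij hj ha
  rcases chord _ _ (hne' i j hij hj) ha with h | h
  all_goals
    have h := congrArg Fin.val h
    rw [Fin.val_add, val i (by omega), val j hj] at h
    change _ = (_ + 1) % 9 at h
    omega

lemma Hep.no9' (hG : Hep G) {a b c d e f g h i : V} (h1 : G.Adj a b) (h2 : G.Adj b c)
    (h3 : G.Adj c d) (h4 : G.Adj d e) (h5 : G.Adj e f) (h6 : G.Adj f g) (h7 : G.Adj g h)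
    (h8 : G.Adj h i) (h9 : G.Adj i a) (n1 : a ≠ c) (n2 : b ≠ d) (n3 : c ≠ e) (n4 : d ≠ f)
    (n5 : e ≠ g) (n6 : f ≠ h) (n7 : g ≠ i) (n8 : h ≠ a) (n9 : i ≠ b) : False := by
  apply hG.no9 ![a, b, c, d, e, f, g, h, i]
  · intro k
    fin_cases k
    exacts [h1, h2, h3, h4, h5, h6, h7, h8, h9]
  · intro k
    fin_cases k
    exacts [n1, n2, n3, n4, n5, n6, n7, n8, n9]

/-- The vertices `c 0, …, c 6` form a cycle of `G` in this order. -/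
structure Hole (G : SimpleGraph V) (c : Fin 7 → V) : Prop where
  inj : Function.Injective c
  adj : ∀ i, G.Adj (c i) (c (i + 1))

/-- The closed neighbourhood of a cycle. -/
def nbhd (G : SimpleGraph V) (c : Fin 7 → V) : Set V :=
  {x | x ∈ Set.range c ∨ ∃ i, G.Adj x (c i)}

lemma Hole.rot {c : Fin 7 → V} (hc : Hole G c) (k : Fin 7) : Hole G fun i => c (i + k) where
  inj i j h := by simpa using hc.inj h
  adj i := by
    have := hc.adj (i + k)
    rwa [add_right_comm] at this

lemma Hole.refl {c : Fin 7 → V} (hc : Hole G c) : Hole G fun i => c (-i) where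
  inj i j h := by simpa using hc.inj h
  adj i := by
    have := hc.adj (-(i + 1))
    rw [show -(i + 1) + 1 = -i by clear * - i; revert i; decide] at this
    exact this.symm

lemma range_rot (c : Fin 7 → V) (k : Fin 7) : Set.range (fun i => c (i + k)) = Set.range c :=
  (Equiv.addRight k).surjective.range_comp c

lemma range_refl (c : Fin 7 → V) : Set.range (fun i => c (-i)) = Set.range c :=
  (Equiv.neg (Fin 7)).surjective.range_comp c

lemma nbhd_rot (c : Fin 7 → V) (k : Fin 7) : nbhd G (fun i => c (i + k)) = nbhd G c := by
  ext x
  simp only [nbhd, range_rot, Set.mem_ofPred_eq]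
  refine or_congr Iff.rfl ⟨fun ⟨i, h⟩ => ⟨_, h⟩, fun ⟨i, h⟩ => ⟨i - k, by simpa using h⟩⟩

lemma nbhd_refl (c : Fin 7 → V) : nbhd G (fun i => c (-i)) = nbhd G c := by
  ext x
  simp only [nbhd, range_refl, Set.mem_ofPred_eq]
  refine or_congr Iff.rfl ⟨fun ⟨i, h⟩ => ⟨_, h⟩, fun ⟨i, h⟩ => ⟨-i, by simpa using h⟩⟩

lemma fin7_cases (i j : Fin 7) : j = i ∨ (j = i + 1 ∨ i = j + 1) ∨ (j = i + 2 ∨ i = j + 2) ∨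
    (j = i + 3 ∨ i = j + 3) := by
  revert i j; decide

section

variable {c : Fin 7 → V} (hG : Hep G) (hc : Hole G c)

include hc

lemma Hole.adj1 (i : Fin 7) : G.Adj (c (i + 1)) (c (i + 2)) := by
  have := hc.adj (i + 1)
  rwa [show i + 1 + 1 = i + 2 by clear * - i; revert i; decide] at this

lemma Hole.adj2 (i : Fin 7) : G.Adj (c (i + 2)) (c (i + 3)) := by
  have := hc.adj (i + 2)
  rwa [show i + 2 + 1 = i + 3 by clear * - i; revert i; decide] at this

lemma Hole.ne {i j : Fin 7} (h : i ≠ j) : c i ≠ c j := fun e => h (hc.inj e)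

include hG

lemma Hole.chordless {i j : Fin 7} (h : G.Adj (c i) (c j)) : j = i + 1 ∨ i = j + 1 := by
  have n2 : ∀ i, ¬ G.Adj (c i) (c (i + 2)) := fun i h => hG.no3 (hc.adj i) (hc.adj1 i) h.symm
  have n3 : ∀ i, ¬ G.Adj (c i) (c (i + 3)) := fun i h =>
    hG.no4 (hc.adj i) (hc.adj1 i) (hc.adj2 i) h.symm
      (hc.ne (by clear * - i; revert i; decide)) (hc.ne (by clear * - i; revert i; decide))
  rcases fin7_cases i j with rfl | h1 | (rfl | rfl) | (rfl | rfl)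
  exacts [absurd h (G.loopless.irrefl _), h1, (n2 _ h).elim, (n2 _ h.symm).elim,
    (n3 _ h).elim, (n3 _ h.symm).elim]

lemma Hole.eq_of_adj {x : V} (hx : x ∉ Set.range c) {i j : Fin 7} (h1 : G.Adj x (c i))
    (h2 : G.Adj x (c j)) : i = j := by
  have hx' : ∀ i, x ≠ c i := fun i h => hx ⟨i, h.symm⟩
  have n1 : ∀ i, G.Adj x (c i) → ¬ G.Adj x (c (i + 1)) := fun i h h' =>
    hG.no3 h (hc.adj i) h'.symm
  have n2 : ∀ i, G.Adj x (c i) → ¬ G.Adj x (c (i + 2)) := fun i h h' =>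
    hG.no4 h (hc.adj i) (hc.adj1 i) h'.symm (hx' _) (hc.ne (by clear * - i; revert i; decide))
  have n3 : ∀ i, G.Adj x (c i) → ¬ G.Adj x (c (i + 3)) := fun i h h' =>
    hG.no5 h (hc.adj i) (hc.adj1 i) (hc.adj2 i) h'.symm
  rcases fin7_cases i j with rfl | (rfl | rfl) | (rfl | rfl) | (rfl | rfl)
  exacts [rfl, (n1 _ h1 h2).elim, (n1 _ h2 h1).elim, (n2 _ h1 h2).elim, (n2 _ h2 h1).elim,
    (n3 _ h1 h2).elim, (n3 _ h2 h1).elim]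

lemma Hole.not_adj {x y : V} (hx : x ∉ Set.range c) (hy : y ∉ Set.range c) {i j : Fin 7}
    (h1 : G.Adj x (c i)) (h2 : G.Adj y (c j)) : ¬ G.Adj x y := by
  intro hxy
  have key : ∀ x y i j, x ∉ Set.range c → y ∉ Set.range c → G.Adj x (c i) → G.Adj y (c j) →
      G.Adj x y → j ≠ i ∧ j ≠ i + 1 ∧ j ≠ i + 2 ∧ j ≠ i + 3 := by
    clear h1 h2 hxy hx hy
    intro x y i j hx hy h1 h2 hxy
    have hx' : ∀ i, x ≠ c i := fun i h => hx ⟨i, h.symm⟩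
    have hy' : ∀ i, y ≠ c i := fun i h => hy ⟨i, h.symm⟩
    refine ⟨?_, ?_, ?_, ?_⟩ <;> rintro rfl
    · exact hG.no3 h1 h2.symm hxy.symm
    · exact hG.no4 h1 (hc.adj i) h2.symm hxy.symm (hx' _) (hy' _).symm
    · exact hG.no5 h1 (hc.adj i) (hc.adj1 i) h2.symm hxy.symm
    · exact hG.no6 h1 (hc.adj i) (hc.adj1 i) (hc.adj2 i) h2.symm hxy.symm (hx' _)
        (hc.ne (by clear * - i; revert i; decide))
        (hc.ne (by clear * - i; revert i; decide)) (hy' _).symm (hx' _).symm (hy' _)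
  have k1 := key x y i j hx hy h1 h2 hxy
  have k2 := key y x j i hy hx h2 h1 hxy.symm
  rcases fin7_cases i j with h | h | h | h <;> tauto

end

/-- A walk from `p` to `q` with all inner vertices in `S`. -/
structure IsWk (G : SimpleGraph V) (S : Set V) (p q : V) (n : ℕ) (f : ℕ → V) : Prop where
  fst : f 0 = p
  lst : f n = q
  adj : ∀ i, i < n → G.Adj (f i) (f (i + 1))
  mem : ∀ i, 0 < i → i < n → f i ∈ S

/-- A sequence `f 0, …, f n` is an induced path. -/
structure IsInd (G : SimpleGraph V) (n : ℕ) (f : ℕ → V) : Prop where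
  inj : ∀ i j, i < j → j ≤ n → f i ≠ f j
  chordless : ∀ i j, i < j → j ≤ n → G.Adj (f i) (f j) → j = i + 1

lemma IsWk.cut {S : Set V} {p q : V} {n : ℕ} {f : ℕ → V} (h : IsWk G S p q n f) {i d : ℕ}
    (hi : i + d ≤ n) (h0 : i + d = n → f (i + d) = f i)
    (h1 : i + d < n → G.Adj (f i) (f (i + d + 1))) :
    IsWk G S p q (n - d) fun k => if k ≤ i then f k else f (k + d) := by
  refine ⟨by simp [h.fst], ?_, ?_, ?_⟩
  · by_cases hd : n - d ≤ i
    · have : i + d = n := by omega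
      have h0 := h0 this
      rw [if_pos hd, show n - d = i by omega, ← h0, this, h.lst]
    · rw [if_neg hd, show n - d + d = n by omega, h.lst]
  · intro k hk
    rcases lt_trichotomy k i with hlt | rfl | hlt
    · rw [if_pos hlt.le, if_pos (by omega)]
      exact h.adj k (by omega)
    · rw [if_pos le_rfl, if_neg (by omega), add_right_comm]
      exact h1 (by omega)
    · rw [if_neg (by omega), if_neg (by omega), add_right_comm]
      exact h.adj _ (by omega)
  · intro k hk hkn
    split_ifs
    exacts [h.mem k hk (by omega), h.mem _ (by omega) (by omega)]

lemma IsWk.exists_isInd {S : Set V} {p q : V} {n : ℕ} {f : ℕ → V} (h : IsWk G S p q n f) :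
    ∃ m g, IsWk G S p q m g ∧ IsInd G m g := by
  classical
  have hex : ∃ m, ∃ g, IsWk G S p q m g := ⟨n, f, h⟩
  obtain ⟨g, hg⟩ := Nat.find_spec hex
  have hmin : ∀ m g', IsWk G S p q m g' → Nat.find hex ≤ m := fun m g' h' =>
    Nat.find_min' hex ⟨g', h'⟩
  refine ⟨_, g, hg, ⟨?_, ?_⟩⟩
  · intro i j hij hj he
    obtain ⟨d, rfl⟩ := Nat.exists_eq_add_of_lt hij
    have := hmin _ _ (hg.cut (i := i) (d := d + 1) (by omega) (fun _ => he.symm)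
      (fun hlt => by rw [he]; exact hg.adj _ hlt))
    omega
  · intro i j hij hj ha
    by_contra hne
    obtain ⟨d, rfl⟩ : ∃ d, j = i + (d + 1) + 1 := ⟨j - i - 2, by omega⟩
    have := hmin _ _ (hg.cut (i := i) (d := d + 1) (by omega) (fun _ => by omega) (fun _ => ha))
    omega

lemma IsInd.reverse {n : ℕ} {f : ℕ → V} (h : IsInd G n f) : IsInd G n fun i => f (n - i) where
  inj i j hij hj := (h.inj _ _ (by omega) (by omega)).symm
  chordless i j hij hj ha := by
    have := h.chordless (n - j) (n - i) (by omega) (by omega) ha.symm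
    omega

lemma IsWk.reverse {S : Set V} {p q : V} {n : ℕ} {f : ℕ → V} (h : IsWk G S p q n f) :
    IsWk G S q p n fun i => f (n - i) where
  fst := h.lst
  lst := by simp [h.fst]
  adj i hi := by
    have := h.adj (n - (i + 1)) (by omega)
    rw [show n - (i + 1) + 1 = n - i by omega] at this
    exact this.symm
  mem i h0 hi := h.mem _ (by omega) (by omega)

lemma val_ofNat {n : ℕ} (h : n < 7) : ((Fin.ofNat 7 n : Fin 7) : ℕ) = n := Nat.mod_eq_of_lt h

lemma ofNat_succ (n : ℕ) : Fin.ofNat 7 (n + 1) = Fin.ofNat 7 n + 1 := by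
  ext; simp [Fin.val_add]

lemma Hole.arc {c : Fin 7 → V} (hG : Hep G) (hc : Hole G c) {S : Set V}
    (hS : ∀ x ∈ S, x ∉ nbhd G c) {p q : V} (hp : p ∉ Set.range c) (hq : q ∉ Set.range c)
    {m : ℕ} {f : ℕ → V} (hf : IsWk G S p q m f) (hf' : IsInd G m f) {e : ℕ} (h2 : 2 ≤ e)
    (h5 : e ≤ 5) (hpc : G.Adj p (c 0)) (hqc : G.Adj q (c (Fin.ofNat 7 e))) :
    7 ≤ m + e + 2 ∧ (Odd (m + e + 2) → m + e + 2 < 9) := by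
  have hinj : ∀ i j, i < j → j ≤ e → Fin.ofNat 7 i ≠ Fin.ofNat 7 j := by
    intro i j hij hj he
    have := congrArg Fin.val he
    rw [val_ofNat (by omega), val_ofNat (by omega)] at this
    omega
  have hch : ∀ i j, i < j → j ≤ e → G.Adj (c (Fin.ofNat 7 i)) (c (Fin.ofNat 7 j)) →
      j = i + 1 := by
    intro i j hij hj ha
    rcases hc.chordless hG ha with h | h
    all_goals
      have h := congrArg Fin.val h
      rw [Fin.val_add, val_ofNat (by omega), val_ofNat (by omega)] at h
      change _ = (_ + 1) % 7 at h
      omega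
  have hoff : ∀ i, i ≤ m → f i ∉ Set.range c := by
    intro i hi
    rcases Nat.eq_zero_or_pos i with rfl | h0
    · rwa [hf.fst]
    · rcases hi.lt_or_eq with hi | rfl
      · exact fun h => hS _ (hf.mem i h0 hi) (Or.inl h)
      · rwa [hf.lst]
  have hadj : ∀ i k, i ≤ m → k ≤ e → G.Adj (f i) (c (Fin.ofNat 7 k)) →
      (i = 0 ∧ k = 0) ∨ (i = m ∧ k = e) := by
    intro i k hi hk ha
    rcases Nat.eq_zero_or_pos i with rfl | h0
    · refine Or.inl ⟨rfl, ?_⟩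
      rw [hf.fst] at ha
      by_contra hk0
      exact hinj 0 k (by omega) hk (hc.eq_of_adj hG hp hpc ha)
    · rcases hi.lt_or_eq with hi | rfl
      · exact absurd (Or.inr ⟨_, ha⟩) (hS _ (hf.mem i h0 hi))
      · refine Or.inr ⟨rfl, ?_⟩
        rw [hf.lst] at ha
        by_contra hk0
        exact hinj k e (by omega) le_rfl (hc.eq_of_adj hG hq ha hqc)
  set g : ℕ → V := fun i => if i ≤ e then c (Fin.ofNat 7 i) else f (m + e + 1 - i) with hg
  have hcyc : IsCyc G (m + e + 2) g := by
    refine ⟨by omega, ?_, ?_, ?_⟩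
    · intro i j hij hj
      simp only [hg]
      split_ifs with h1 h2 h2
      · exact hc.ne (hinj i j hij h2)
      · exact fun h => hoff _ (by omega) ⟨_, h⟩
      · omega
      · exact (hf'.inj _ _ (by omega) (by omega)).symm
    · intro i hi
      simp only [hg]
      split_ifs with h1 h2 h2
      · rw [ofNat_succ]
        exact hc.adj _
      · rw [show m + e + 1 - (i + 1) = m by omega, hf.lst, show i = e by omega]
        exact hqc.symm
      · omega
      · have := hf.adj (m + e + 1 - (i + 1)) (by omega)
        rw [show m + e + 1 - (i + 1) + 1 = m + e + 1 - i by omega] at this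
        exact this.symm
    · simp only [hg]
      rw [if_pos (by omega), if_neg (by omega),
        show m + e + 1 - (m + e + 2 - 1) = 0 by omega, hf.fst]
      exact hpc.symm
  refine ⟨hG.girth _ _ hcyc, hG.hole _ _ hcyc ?_⟩
  intro i j hij hj ha
  simp only [hg] at ha
  split_ifs at ha with h1 h2 h2
  · exact Or.inl (hch i j hij h2 ha)
  · rcases hadj _ _ (by omega) h1 ha.symm with h | h <;> omega
  · omega
  · have := hf'.chordless _ _ (by omega) (by omega) ha.symm
    omega

section

variable {c : Fin 7 → V} (hG : Hep G) (hc : Hole G c) {S : Set V}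
  (hS : ∀ x ∈ S, x ∉ nbhd G c) {p q : V} (hp : p ∉ Set.range c) (hq : q ∉ Set.range c)
  {n : ℕ} {f : ℕ → V} (hf : IsWk G S p q n f) {i : Fin 7} (hpc : G.Adj p (c i))

include hG hc hS hp hq hf hpc

lemma Hole.jump {e : ℕ} (h2 : 2 ≤ e) (h5 : e ≤ 3) (hqc : G.Adj q (c (Fin.ofNat 7 e + i))) :
    ∃ g, IsWk G S p q (5 - e) g := by
  obtain ⟨m, g, hg, hg'⟩ := hf.exists_isInd
  have hS1 : ∀ k, ∀ x ∈ S, x ∉ nbhd G fun i => c (i + k) := by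
    intro k; rw [nbhd_rot]; exact hS
  have hr : ∀ x, x ∉ Set.range c → ∀ k, x ∉ Set.range fun i => c (i + k) := by
    intro x hx k; rwa [range_rot]
  have a1 := (hc.rot i).arc hG (hS1 i) (hr p hp i) (hr q hq i) hg hg' h2 (by omega)
    (by simpa using hpc) hqc
  have a2 := (hc.rot (Fin.ofNat 7 e + i)).arc hG (hS1 _) (hr q hq _) (hr p hp _) hg.reverse
    hg'.reverse (e := 7 - e) (by omega) (by omega) (by simpa using hqc) (by
      have : Fin.ofNat 7 (7 - e) + (Fin.ofNat 7 e + i) = i := by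
        rw [← add_assoc]
        clear * - h2 h5; interval_cases e <;> revert i <;> decide
      rwa [this])
  have hm : m = 5 - e := by
    rcases Nat.even_or_odd (m + e) with ⟨k, hk⟩ | ⟨k, hk⟩
    · have := a2.2 ⟨k + 4 - e, by omega⟩
      omega
    · have := a1.2 ⟨k + 1, by omega⟩
      omega
  exact ⟨g, hm ▸ hg⟩

lemma Hole.jump2 (hqc : G.Adj q (c (i + 2))) :
    ∃ a b, a ∈ S ∧ b ∈ S ∧ G.Adj p a ∧ G.Adj a b ∧ G.Adj b q := by
  obtain ⟨g, hg⟩ := hc.jump hG hS hp hq hf hpc (e := 2) le_rfl (by omega)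
    (by rw [add_comm]; exact hqc)
  have h0 := hg.adj 0 (by omega)
  have h2 := hg.adj 2 (by omega)
  rw [hg.fst] at h0
  rw [show 2 + 1 = 5 - 2 by omega, hg.lst] at h2
  exact ⟨g 1, g 2, hg.mem 1 (by omega) (by omega), hg.mem 2 (by omega) (by omega), h0,
    hg.adj 1 (by omega), h2⟩

lemma Hole.jump3 (hqc : G.Adj q (c (i + 3))) : ∃ w, w ∈ S ∧ G.Adj p w ∧ G.Adj w q := by
  obtain ⟨g, hg⟩ := hc.jump hG hS hp hq hf hpc (e := 3) (by omega) le_rfl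
    (by rw [add_comm]; exact hqc)
  have h0 := hg.adj 0 (by omega)
  have h1 := hg.adj 1 (by omega)
  rw [hg.fst] at h0
  rw [show 1 + 1 = 5 - 3 by omega, hg.lst] at h1
  exact ⟨g 1, hg.mem 1 (by omega) (by omega), h0, h1⟩

end

/-- A set of vertices inducing a graph that is not bipartite contains a cycle of length seven. -/
lemma Hep.exists_hole (hG : Hep G) {W : Set V} (hW : ¬ (G.induce W).Colorable 2) :
    ∃ c, Hole G c ∧ ∀ i, c i ∈ W := by
  classical
  have hex : ∃ N, Odd N ∧ ∃ g : ℕ → V, (∀ i, i < N → G.Adj (g i) (g (i + 1))) ∧ g N = g 0 ∧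
      ∀ i, i ≤ N → g i ∈ W := by
    rw [SimpleGraph.two_colorable_iff_forall_loop_even] at hW
    push Not at hW
    obtain ⟨u, w, hw⟩ := hW
    refine ⟨w.length, Nat.not_even_iff_odd.1 hw, fun i => w.getVert i, ?_, by simp,
      fun i _ => (w.getVert i).2⟩
    intro i hi
    exact w.adj_getVert_succ hi
  obtain ⟨hodd, g, hadj, hcl, hgW⟩ := Nat.find_spec hex
  set N := Nat.find hex with hN
  have hmin : ∀ m, m < N → Odd m → ∀ g : ℕ → V, (∀ i, i < m → G.Adj (g i) (g (i + 1))) →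
      g m = g 0 → ¬ ∀ i, i ≤ m → g i ∈ W := fun m hm ho g' h1 h2 h3 =>
    Nat.find_min hex hm ⟨ho, g', h1, h2, h3⟩
  have hinner : ∀ i j, i < j → j ≤ N → j - i < N → g i = g j → ¬ Odd (j - i) := by
    intro i j hij hj hlt he ho
    refine hmin _ hlt ho (fun k => g (i + k)) (fun k hk => hadj _ (by omega)) ?_
      (fun k hk => hgW _ (by omega))
    simp only [show i + (j - i) = j by omega, add_zero]
    exact he.symm
  have hwk : IsWk G W (g 0) (g 0) N g := ⟨rfl, hcl, hadj, fun i _ hi => hgW i hi.le⟩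
  have hwmin : ∀ m, m < N → Odd m → ∀ g', ¬ IsWk G W (g 0) (g 0) m g' := by
    intro m hm ho g' hg'
    refine hmin m hm ho g' hg'.adj (hg'.lst.trans hg'.fst.symm) fun i hi => ?_
    rcases Nat.eq_zero_or_pos i with rfl | h0
    · rw [hg'.fst]; exact hgW 0 (by omega)
    · rcases hi.lt_or_eq with hi | rfl
      · exact hg'.mem i h0 hi
      · rw [hg'.lst]; exact hgW 0 (by omega)
  have h3 : 3 ≤ N := by
    by_contra h
    have h1 : N = 1 := by obtain ⟨k, hk⟩ := hodd; omega
    have := hadj 0 (by omega)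
    rw [zero_add, ← h1, hcl] at this
    exact G.loopless.irrefl _ this
  have hinj : ∀ i j, i < j → j < N → g i ≠ g j := by
    intro i j hij hj he
    rcases Nat.even_or_odd (j - i) with hev | ho
    · refine hwmin (N - (j - i)) (by omega) (Nat.Odd.sub_even (by omega) hodd hev) _
        (hwk.cut (i := i) (d := j - i) (by omega) (fun _ => by omega) fun _ => ?_)
      rw [he, show i + (j - i) = j by omega]
      exact hadj j hj
    · exact hinner i j hij hj.le (by omega) he ho
  have hcyc : IsCyc G N g := by
    refine ⟨h3, hinj, fun i hi => hadj i (by omega), ?_⟩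
    have := hadj (N - 1) (by omega)
    rw [show N - 1 + 1 = N by omega, hcl] at this
    exact this.symm
  have hch : Chordless G N g := by
    intro i j hij hj ha
    by_contra hcon
    push Not at hcon
    rcases Nat.even_or_odd (j - i) with hev | ho
    · refine hmin (j - i + 1) ?_ hev.add_one
        (fun k => if k ≤ j - i then g (i + k) else g i) ?_ (by simp) ?_
      · rcases Nat.eq_zero_or_pos i with rfl | h0
        · have := hcon.2 rfl
          omega
        · omega
      · intro k hk
        rw [if_pos (by omega)]
        split_ifs with h
        · exact hadj _ (by omega)
        · rw [show i + k = j by omega]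
          exact ha.symm
      · intro k hk
        split_ifs
        exacts [hgW _ (by omega), hgW _ (by omega)]
    · have hne := hcon.1
      refine hwmin (N - (j - i - 1)) (by omega)
        (Nat.Odd.sub_even (by omega) hodd (Nat.Odd.sub_odd ho odd_one)) _
        (hwk.cut (i := i) (d := j - i - 1) (by omega) (fun _ => by omega) fun _ => ?_)
      rw [show i + (j - i - 1) + 1 = j by omega]
      exact ha
  have h7 : N = 7 := by
    have := hG.girth _ _ hcyc
    have := hG.hole _ _ hcyc hch hodd
    obtain ⟨k, hk⟩ := hodd
    omega
  clear_value N
  subst h7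
  refine ⟨fun i => g i, ⟨?_, ?_⟩, fun i => hgW _ i.2.le⟩
  · intro i j he
    rcases lt_trichotomy (i : ℕ) j with h | h | h
    · exact absurd he (hinj _ _ h j.2)
    · exact Fin.ext h
    · exact absurd he.symm (hinj _ _ h i.2)
  · intro i
    have := hadj i i.2
    by_cases h : (i : ℕ) + 1 < 7
    · rw [show ((i + 1 : Fin 7) : ℕ) = i + 1 by
        rw [Fin.val_add]; exact Nat.mod_eq_of_lt h]
      exact this
    · obtain rfl : i = 6 := Fin.ext (by have := i.2; change (i : ℕ) = 6; omega)
      change G.Adj (g 6) (g 0)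
      rw [← hcl]
      exact this

/-- `U` is the vertex set of a component of the graph obtained by deleting the closed
neighbourhood of `c`. -/
structure IsComp (G : SimpleGraph V) (c : Fin 7 → V) (U : Set V) : Prop where
  nonempty : U.Nonempty
  far : ∀ x ∈ U, x ∉ nbhd G c
  conn : ∀ x ∈ U, ∀ y ∈ U, ∃ n f, IsWk G U x y n f
  closed : ∀ x ∈ U, ∀ y, G.Adj x y → y ∉ nbhd G c → y ∈ U

/-- The vertex `p` is adjacent both to `c i` and to some vertex of `U`. -/
def Att (G : SimpleGraph V) (c : Fin 7 → V) (U : Set V) (p : V) (i : Fin 7) : Prop :=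
  G.Adj p (c i) ∧ ∃ x ∈ U, G.Adj p x

lemma exists_isComp (c : Fin 7 → V) {x : V} (hx : x ∉ nbhd G c) : ∃ U, IsComp G c U ∧ x ∈ U := by
  refine ⟨{y | ∃ h : y ∈ (nbhd G c)ᶜ, (G.induce (nbhd G c)ᶜ).Reachable ⟨x, hx⟩ ⟨y, h⟩},
    ⟨⟨x, hx, .rfl⟩, fun y hy => hy.1, ?_, ?_⟩, ⟨hx, .rfl⟩⟩
  · rintro y ⟨hy, hy'⟩ z ⟨hz, hz'⟩
    obtain ⟨w⟩ := hy'.symm.trans hz'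
    exact ⟨w.length, fun i => w.getVert i, by simp, by simp, fun i hi => w.adj_getVert_succ hi,
      fun i _ _ => ⟨(w.getVert i).2, hy'.trans ⟨w.take i⟩⟩⟩
  · rintro y ⟨hy, hy'⟩ z hyz hz
    exact ⟨hz, hy'.trans (SimpleGraph.Adj.reachable (G := G.induce _) hyz)⟩

lemma IsComp.subset {c : Fin 7 → V} {Q U : Set V} (hQ : IsComp G c Q) {z : V} (hzQ : z ∈ Q)
    (hzU : z ∈ U) (h : ∀ x ∈ U, ∀ y ∈ Q, G.Adj x y → y ∈ U) : Q ⊆ U := by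
  intro y hy
  obtain ⟨n, f, hf⟩ := hQ.conn z hzQ y hy
  have : ∀ i, i ≤ n → f i ∈ U := by
    intro i
    induction i with
    | zero => intro _; rwa [hf.fst]
    | succ i ih =>
      intro hi
      refine h _ (ih (by omega)) _ ?_ (hf.adj i (by omega))
      rcases hi.lt_or_eq with hi | rfl
      · exact hf.mem _ (by omega) hi
      · rwa [hf.lst]
  rw [← hf.lst]
  exact this n le_rfl

lemma IsComp.rot {c : Fin 7 → V} {U : Set V} (hU : IsComp G c U) (k : Fin 7) :
    IsComp G (fun i => c (i + k)) U :=
  ⟨hU.nonempty, by rw [nbhd_rot]; exact hU.far, hU.conn, by rw [nbhd_rot]; exact hU.closed⟩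

lemma IsComp.refl {c : Fin 7 → V} {U : Set V} (hU : IsComp G c U) :
    IsComp G (fun i => c (-i)) U :=
  ⟨hU.nonempty, by rw [nbhd_refl]; exact hU.far, hU.conn, by rw [nbhd_refl]; exact hU.closed⟩

lemma IsWk.cons {S : Set V} {p x q : V} {n : ℕ} {f : ℕ → V} (h : IsWk G S x q n f)
    (hpx : G.Adj p x) (hx : x ∈ S) :
    IsWk G S p q (n + 1) fun i => if i = 0 then p else f (i - 1) where
  fst := rfl
  lst := by simp [h.lst]
  adj i hi := by
    rcases Nat.eq_zero_or_pos i with rfl | h0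
    · simpa [h.fst] using hpx
    · have := h.adj (i - 1) (by omega)
      rw [Nat.sub_add_cancel h0] at this
      simpa [h0.ne'] using this
  mem i h0 hi := by
    rw [if_neg h0.ne']
    rcases Nat.eq_zero_or_pos (i - 1) with h1 | h1
    · rwa [h1, h.fst]
    · exact h.mem _ h1 (by omega)

lemma Hole.common1 {c : Fin 7 → V} {U : Set V} (hG : Hep G) (hc : Hole G c)
    {x p q : V} {i : Fin 7} (hp : Att G c U p i) (hq : Att G c U q (i + 1)) (hxp : G.Adj x p)
    (hxq : G.Adj x q) : False :=
  hG.no5 hxp hp.1 (hc.adj i) hq.1.symm hxq.symm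

section

variable {c : Fin 7 → V} {U : Set V} (hU : IsComp G c U)

include hU

lemma IsComp.ne_hole {x : V} (hx : x ∈ U) (i : Fin 7) : x ≠ c i :=
  fun h => hU.far x hx (Or.inl ⟨i, h.symm⟩)

lemma IsComp.ne_att {x p : V} (hx : x ∈ U) {i : Fin 7} (hp : Att G c U p i) : x ≠ p := by
  rintro rfl
  exact hU.far x hx (Or.inr ⟨i, hp.1⟩)

lemma IsComp.att_notMem_range {p : V} {i : Fin 7} (hp : Att G c U p i) : p ∉ Set.range c := by
  rintro ⟨j, rfl⟩
  obtain ⟨-, x, hx, hpx⟩ := hp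
  exact hU.far x hx (Or.inr ⟨j, hpx.symm⟩)

lemma IsComp.att_ne_hole {p : V} {i : Fin 7} (hp : Att G c U p i) (j : Fin 7) : p ≠ c j :=
  fun h => hU.att_notMem_range hp ⟨j, h.symm⟩

lemma IsComp.exists_att {x y : V} (hx : x ∈ U) (hy : y ∉ U) (h : G.Adj x y) :
    ∃ i, Att G c U y i := by
  have : y ∈ nbhd G c := by
    by_contra hn
    exact hy (hU.closed x hx y h hn)
  rcases this with ⟨i, rfl⟩ | ⟨i, hi⟩
  · exact absurd (Or.inr ⟨i, h⟩) (hU.far x hx)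
  · exact ⟨i, hi, x, hx, h.symm⟩

lemma IsComp.exists_isWk {p q : V} {i j : Fin 7} (hp : Att G c U p i) (hq : Att G c U q j) :
    ∃ n f, IsWk G U p q n f := by
  obtain ⟨-, x, hx, hpx⟩ := hp
  obtain ⟨-, y, hy, hqy⟩ := hq
  obtain ⟨n, f, hf⟩ := hU.conn x hx y hy
  exact ⟨_, _, ((hf.cons hpx hx).reverse.cons hqy hy).reverse⟩

variable (hG : Hep G) (hc : Hole G c)

include hG

lemma IsComp.eq_of_common {x p q : V} {i : Fin 7} (hx : x ∈ U) (hp : Att G c U p i)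
    (hq : Att G c U q i) (hxp : G.Adj x p) (hxq : G.Adj x q) : p = q := by
  by_contra hne
  exact hG.no4 hxp hp.1 hq.1.symm hxq.symm (hU.ne_hole hx _) hne

include hc

lemma IsComp.att_ne {p q : V} {i j : Fin 7} (hp : Att G c U p i) (hq : Att G c U q j)
    (h : i ≠ j) : p ≠ q := by
  rintro rfl
  exact h (hc.eq_of_adj hG (hU.att_notMem_range hp) hp.1 hq.1)

lemma IsComp.jump2 {p q : V} {i : Fin 7} (hp : Att G c U p i) (hq : Att G c U q (i + 2)) :
    ∃ a b, a ∈ U ∧ b ∈ U ∧ G.Adj p a ∧ G.Adj a b ∧ G.Adj b q := by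
  obtain ⟨n, f, hf⟩ := hU.exists_isWk hp hq
  exact hc.jump2 hG hU.far (hU.att_notMem_range hp) (hU.att_notMem_range hq) hf hp.1 hq.1

lemma IsComp.jump3 {p q : V} {i : Fin 7} (hp : Att G c U p i) (hq : Att G c U q (i + 3)) :
    ∃ w, w ∈ U ∧ G.Adj p w ∧ G.Adj w q := by
  obtain ⟨n, f, hf⟩ := hU.exists_isWk hp hq
  exact hc.jump3 hG hU.far (hU.att_notMem_range hp) (hU.att_notMem_range hq) hf hp.1 hq.1

lemma IsComp.edge1 {x y p q : V} {i : Fin 7} (hx : x ∈ U) (hy : y ∈ U) (hp : Att G c U p i)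
    (hq : Att G c U q (i + 1)) (hxp : G.Adj x p) (hyq : G.Adj y q) (hxy : G.Adj x y) : False :=
  hG.no6 hxp hp.1 (hc.adj i) hq.1.symm hyq.symm hxy.symm (hU.ne_hole hx _)
    (hU.att_ne_hole hp _) (hU.att_ne_hole hq _).symm (hU.ne_hole hy _).symm
    (hU.ne_att hx hq).symm (hU.ne_att hy hp)

lemma IsComp.att_unique {p p' q : V} {i : Fin 7} (hp : Att G c U p i) (hp' : Att G c U p' i)
    (hq : Att G c U q (i + 3)) : p = p' := by
  by_contra hne
  obtain ⟨w, hw, h1, h2⟩ := hU.jump3 hG hc hp hq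
  obtain ⟨w', hw', h1', h2'⟩ := hU.jump3 hG hc hp' hq
  have hpq : ∀ {p}, Att G c U p i → p ≠ q := fun h =>
    hU.att_ne hG hc h hq (by clear * - i; revert i; decide)
  have hww : w ≠ w' := by
    rintro rfl
    exact hne (hU.eq_of_common hG hw hp hp' h1.symm h1'.symm)
  exact hG.no6 h1 h2 h2'.symm h1'.symm hp'.1 hp.1.symm (hpq hp) hww (hpq hp').symm
    (hU.ne_hole hw' _) (Ne.symm hne) (hU.ne_hole hw _).symm

lemma IsComp.att_unique' {p q q' : V} {i : Fin 7} (hp : Att G c U p i)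
    (hq : Att G c U q (i + 3)) (hq' : Att G c U q' (i + 3)) : q = q' := by
  by_contra hne
  obtain ⟨w, hw, h1, h2⟩ := hU.jump3 hG hc hp hq
  obtain ⟨w', hw', h1', h2'⟩ := hU.jump3 hG hc hp hq'
  have hpq : ∀ {q}, Att G c U q (i + 3) → q ≠ p := fun h =>
    hU.att_ne hG hc h hp (by clear * - i; revert i; decide)
  have hww : w ≠ w' := by
    rintro rfl
    exact hne (hU.eq_of_common hG hw hq hq' h2 h2')
  exact hG.no6 h2.symm h1.symm h1' h2' hq'.1 hq.1.symm (hpq hq) hww (hpq hq').symm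
    (hU.ne_hole hw' _) (Ne.symm hne) (hU.ne_hole hw _).symm

lemma IsComp.not_att_1245 {p1 p2 p4 p5 : V} (h1 : Att G c U p1 1) (h2 : Att G c U p2 2)
    (h4 : Att G c U p4 4) (h5 : Att G c U p5 5) : False := by
  obtain ⟨w, hw, a1, a2⟩ := hU.jump3 hG hc (i := 1) h1 h4
  obtain ⟨a, b, ha, hb, b1, b2, b3⟩ := hU.jump2 hG hc (i := 2) h2 h4
  obtain ⟨x, hx, x1, x2⟩ := hU.jump3 hG hc (i := 2) h2 h5
  obtain ⟨y, hy, y1, y2⟩ := hU.jump3 hG hc (i := 5) h5 h1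
  refine hG.no9' a1 a2 b3.symm b2.symm b1.symm x1 x2 y1 y2 (hU.att_ne hG hc h1 h4 (by decide)) ?_
    (hU.ne_att ha h4).symm (hU.ne_att hb h2) ?_ (hU.att_ne hG hc h2 h5 (by decide)) ?_
    (hU.att_ne hG hc h5 h1 (by decide)) ?_
  · rintro rfl
    exact hU.edge1 hG hc (i := 1) hw ha h1 h2 a1.symm b1.symm b2.symm
  · rintro rfl
    exact hU.edge1 hG hc (i := 4) hb ha h4 h5 b3 x2 b2.symm
  · rintro rfl
    exact hc.common1 hG (i := 1) h1 h2 y2 x1.symm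
  · rintro rfl
    exact hc.common1 hG (i := 4) h4 h5 a2 y1.symm

lemma IsComp.exists_hub {p1 p3 p5 : V} (h1 : Att G c U p1 1) (h3 : Att G c U p3 3)
    (h5 : Att G c U p5 5) : ∃ w q, w ∈ U ∧ q ∈ U ∧ G.Adj p1 w ∧ G.Adj p5 w ∧ G.Adj p3 q ∧
      G.Adj q w := by
  obtain ⟨v, hv, v1, v2⟩ := hU.jump3 hG hc (i := 5) h5 h1
  obtain ⟨x, hx, hpx⟩ := h3.2
  obtain ⟨n, f, hf⟩ := hU.conn x hx v hv
  obtain ⟨m, g, hg, hg'⟩ := (hf.cons hpx hx).exists_isInd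
  have hm : 0 < m := by
    rcases Nat.eq_zero_or_pos m with rfl | h
    · exact absurd (hg.lst.symm.trans hg.fst) (hU.ne_att hv h3)
    · exact h
  set S : Set V := {x | ∃ i, 0 < i ∧ i ≤ m ∧ g i = x} with hS
  have hSU : S ⊆ U := by
    rintro _ ⟨i, h0, hi, rfl⟩
    rcases hi.lt_or_eq with hi | rfl
    · exact hg.mem i h0 hi
    · rwa [hg.lst]
  have hgS : IsWk G S p3 v m g := ⟨hg.fst, hg.lst, hg.adj, fun i h0 hi => ⟨i, h0, hi.le, rfl⟩⟩
  have hvS : v ∈ S := ⟨m, hm, le_rfl, hg.lst⟩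
  have key : ∀ a b, a ∈ S → b ∈ S → G.Adj a b → G.Adj b p3 → b = g 1 ∧ a = g 2 ∧ 2 ≤ m := by
    rintro _ _ ⟨i, hi0, hi, rfl⟩ ⟨j, hj0, hj, rfl⟩ hab hb
    rw [← hg.fst] at hb
    have e := hg'.chordless 0 j hj0 hj hb.symm
    subst e
    have hi1 : 1 < i := by
      rcases Nat.lt_or_eq_of_le hi0 with h | rfl
      · exact h
      · exact absurd hab (G.loopless.irrefl _)
    have e := hg'.chordless 1 i hi1 hi hab.symm
    subst e
    exact ⟨rfl, rfl, hi⟩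
  obtain ⟨a, b, ha, hb, e1, e2, e3⟩ := hc.jump2 hG (fun x hx => hU.far x (hSU hx))
    (hU.att_notMem_range h1) (hU.att_notMem_range h3) (hgS.reverse.cons v2.symm hvS) (i := 1)
    h1.1 h3.1
  obtain ⟨a', b', ha', hb', e1', e2', e3'⟩ := hc.jump2 hG (fun x hx => hU.far x (hSU hx))
    (hU.att_notMem_range h3) (hU.att_notMem_range h5) (hgS.reverse.cons v1 hvS).reverse (i := 3)
    h3.1 h5.1
  obtain ⟨rfl, rfl, -⟩ := key a b ha hb e2 e3
  obtain ⟨rfl, rfl, -⟩ := key b' a' hb' ha' e2'.symm e1'.symm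
  exact ⟨_, _, hSU ha, hSU hb, e1, e3'.symm, e3.symm, e2.symm⟩

lemma IsComp.not_att_1356 {p1 p3 p5 p6 : V} (h1 : Att G c U p1 1) (h3 : Att G c U p3 3)
    (h5 : Att G c U p5 5) (h6 : Att G c U p6 6) : False := by
  obtain ⟨w, q, hw, hq, a1, a2, a3, a4⟩ := hU.exists_hub hG hc h1 h3 h5
  obtain ⟨w', q', hw', hq', b1, b2, b3, b4⟩ := (hU.rot 5).exists_hub hG (hc.rot 5) h6 h1 h3
  by_cases e1 : q = w'
  · subst e1
    exact hU.edge1 hG hc (i := 5) hw hq h5 h6 a2.symm b1.symm a4.symm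
  by_cases e2 : q' = w
  · subst e2
    exact hU.edge1 hG hc (i := 5) hw hw' h5 h6 a2.symm b1.symm b4
  exact hG.no6 a1 a4.symm a3.symm b2 b4.symm b3.symm (hU.ne_att hq h1).symm (hU.ne_att hw h3)
    e1 (hU.ne_att hq' h3).symm (hU.ne_att hw' h1) e2

end

lemma Hole.exists_far {c : Fin 7 → V} (hG : Hep G) (hc : Hole G c)
    (hdeg : ∀ v a b, ∃ u, G.Adj v u ∧ u ≠ a ∧ u ≠ b) (i : Fin 7) :
    ∃ p x, G.Adj p (c i) ∧ p ∉ Set.range c ∧ G.Adj p x ∧ x ∉ nbhd G c := by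
  obtain ⟨p, hp, hp1, hp2⟩ := hdeg (c i) (c (i + 1)) (c (i - 1))
  have hpr : p ∉ Set.range c := by
    rintro ⟨j, rfl⟩
    rcases hc.chordless hG hp with rfl | rfl
    · exact hp1 rfl
    · exact hp2 (by simp)
  obtain ⟨x, hx, hx1, -⟩ := hdeg p (c i) (c i)
  have hxr : x ∉ Set.range c := by
    rintro ⟨j, rfl⟩
    exact hx1 (by rw [hc.eq_of_adj hG hpr hp.symm hx])
  refine ⟨p, x, hp.symm, hpr, hx, ?_⟩
  rintro (h | ⟨j, hj⟩)
  · exact hxr h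
  · exact hc.not_adj hG hpr hxr hp.symm hj hx

lemma Hep.hole_mk (hG : Hep G) {a b c d e f g : V} (h1 : G.Adj a b) (h2 : G.Adj b c)
    (h3 : G.Adj c d) (h4 : G.Adj d e) (h5 : G.Adj e f) (h6 : G.Adj f g) (h7 : G.Adj g a)
    (n1 : a ≠ c) (n2 : b ≠ d) (n3 : c ≠ e) (n4 : d ≠ f) (n5 : e ≠ g) (n6 : f ≠ a)
    (n7 : g ≠ b) : Hole G ![a, b, c, d, e, f, g] := by
  set v := ![a, b, c, d, e, f, g] with hv
  have hadj : ∀ i, G.Adj (v i) (v (i + 1)) := by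
    intro i
    fin_cases i
    exacts [h1, h2, h3, h4, h5, h6, h7]
  have hne : ∀ i, v i ≠ v (i + 2) := by
    intro i
    fin_cases i
    exacts [n1, n2, n3, n4, n5, n6, n7]
  clear_value v
  have n3 : ∀ i, v i ≠ v (i + 3) := by
    intro i he
    have a1 := hadj (i + 1)
    have a2 := hadj (i + 2)
    rw [show i + 1 + 1 = i + 2 by clear * - i; revert i; decide] at a1
    rw [show i + 2 + 1 = i + 3 by clear * - i; revert i; decide, ← he] at a2
    exact hG.no3 (hadj i) a1 a2
  refine ⟨fun i j he => ?_, hadj⟩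
  rcases fin7_cases i j with h | (rfl | rfl) | (rfl | rfl) | (rfl | rfl)
  exacts [h.symm, absurd he (hadj _).ne, absurd he (hadj _).ne', absurd he (hne _),
    absurd he.symm (hne _), absurd he (n3 _), absurd he.symm (n3 _)]

/-- No component left after deleting the closed neighbourhood of a 7-cycle is smaller
than `U`. -/
def Least (G : SimpleGraph V) (U : Set V) : Prop :=
  ∀ c Q, Hole G c → IsComp G c Q → ¬ Q ⊂ U

lemma Least.false_of_hole {U : Set V} (hmin : Least G U) (hG : Hep G)
    (hdeg : ∀ v a b, ∃ u, G.Adj v u ∧ u ≠ a ∧ u ≠ b) {c : Fin 7 → V} (hc : Hole G c)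
    (hN : ∀ x ∈ U, ∀ y, y ∉ U → G.Adj x y → y ∈ nbhd G c) (k : Fin 7) (hk : c k ∈ U)
    (hw : ∀ y, y ∉ U → G.Adj y (c k) → y ∈ Set.range c ∨ ∃ i, i ≠ k ∧ G.Adj y (c i)) :
    False := by
  have hsub : U ⊆ nbhd G c := by
    intro z hz
    by_contra hzn
    obtain ⟨Q, hQ, hzQ⟩ := exists_isComp c hzn
    have hQU : Q ⊆ U := hQ.subset hzQ hz fun x hx y hy hxy => by
      by_contra hyU
      exact hQ.far y hy (hN x hx y hyU hxy)
    exact hmin c Q hc hQ ⟨hQU, fun h => hQ.far _ (h hk) (Or.inl ⟨k, rfl⟩)⟩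
  have hall : ∀ x ∈ U, ∀ y, G.Adj x y → y ∈ nbhd G c := fun x hx y hxy => by
    by_cases hy : y ∈ U
    · exact hsub hy
    · exact hN x hx y hy hxy
  obtain ⟨u, hu, hu1, hu2⟩ := hdeg (c k) (c (k + 1)) (c (k - 1))
  have hur : u ∉ Set.range c := by
    rintro ⟨j, rfl⟩
    rcases hc.chordless hG hu with rfl | rfl
    · exact hu1 rfl
    · exact hu2 (by simp)
  have huU : u ∈ U := by
    by_contra huU
    rcases hw u huU hu.symm with h | ⟨i, hi, h⟩
    · exact hur h
    · exact hi (hc.eq_of_adj hG hur h hu.symm)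
  obtain ⟨y, hy, hy1, -⟩ := hdeg u (c k) (c k)
  have hyr : y ∉ Set.range c := by
    rintro ⟨j, rfl⟩
    exact hy1 (by rw [hc.eq_of_adj hG hur hu.symm hy])
  rcases hall u huU y hy with h | ⟨j, hj⟩
  · exact hyr h
  · exact hc.not_adj hG hur hyr hu.symm hj hy

section

variable {c : Fin 7 → V} {U : Set V} (hG : Hep G) (hc : Hole G c) (hU : IsComp G c U)
  (hmin : Least G U) (hdeg : ∀ v a b, ∃ u, G.Adj v u ∧ u ≠ a ∧ u ≠ b)

include hG hc hU hmin hdeg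

lemma IsComp.not_least_14 {p q : V} (hp : Att G c U p 1) (hq : Att G c U q 4)
    (hT : ∀ p i, Att G c U p i → i = 1 ∨ i = 2 ∨ i = 3 ∨ i = 4) : False := by
  obtain ⟨w, hw, w1, w2⟩ := hU.jump3 hG hc (i := 1) hp hq
  have hole := hG.hole_mk (hc.adj 1) (hc.adj 2) (hc.adj 3) hq.1.symm w2.symm w1.symm hp.1
    (hc.ne (by decide)) (hc.ne (by decide)) (hU.att_ne_hole hq _).symm (hU.ne_hole hw _).symm
    (hU.att_ne hG hc hq hp (by decide)) (hU.ne_hole hw _) (hU.att_ne_hole hp _)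
  have key : ∀ x ∈ U, ∀ y, y ∉ U → G.Adj x y →
      ∃ k, k ≠ 5 ∧ G.Adj y (![c 1, c 2, c 3, c 4, q, w, p] k) := by
    intro x hx y hy hxy
    obtain ⟨i, hi⟩ := hU.exists_att hx hy hxy
    rcases hT y i hi with rfl | rfl | rfl | rfl
    exacts [⟨0, by decide, hi.1⟩, ⟨1, by decide, hi.1⟩, ⟨2, by decide, hi.1⟩,
      ⟨3, by decide, hi.1⟩]
  refine hmin.false_of_hole hG hdeg hole (fun x hx y hy hxy => ?_) 5 hw
    fun y hy hyw => Or.inr (key w hw y hy hyw.symm)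
  obtain ⟨k, -, hk⟩ := key x hx y hy hxy
  exact Or.inr ⟨k, hk⟩

lemma IsComp.not_least_13 {p q : V} (hp : Att G c U p 1) (hq : Att G c U q 3)
    (hT : ∀ p i, Att G c U p i → i = 1 ∨ i = 2 ∨ i = 3) : False := by
  obtain ⟨a, b, ha, hb, e1, e2, e3⟩ := hU.jump2 hG hc (i := 1) hp hq
  have hole := hG.hole_mk (hc.adj 1) (hc.adj 2) hq.1.symm e3.symm e2.symm e1.symm hp.1
    (hc.ne (by decide)) (hU.att_ne_hole hq _).symm (hU.ne_hole hb _).symm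
    (hU.ne_att ha hq).symm (hU.ne_att hb hp) (hU.ne_hole ha _) (hU.att_ne_hole hp _)
  have key : ∀ x ∈ U, ∀ y, y ∉ U → G.Adj x y →
      ∃ k, k ≠ 5 ∧ G.Adj y (![c 1, c 2, c 3, q, b, a, p] k) := by
    intro x hx y hy hxy
    obtain ⟨i, hi⟩ := hU.exists_att hx hy hxy
    rcases hT y i hi with rfl | rfl | rfl
    exacts [⟨0, by decide, hi.1⟩, ⟨1, by decide, hi.1⟩, ⟨2, by decide, hi.1⟩]
  refine hmin.false_of_hole hG hdeg hole (fun x hx y hy hxy => ?_) 5 ha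
    fun y hy hyw => Or.inr (key a ha y hy hyw.symm)
  obtain ⟨k, -, hk⟩ := key x hx y hy hxy
  exact Or.inr ⟨k, hk⟩

lemma IsComp.not_least_125 {p1 p2 p5 : V} (h1 : Att G c U p1 1) (h2 : Att G c U p2 2)
    (h5 : Att G c U p5 5) (hT : ∀ p i, Att G c U p i → i = 1 ∨ i = 2 ∨ i = 5) : False := by
  obtain ⟨x, hx, x1, x2⟩ := hU.jump3 hG hc (i := 2) h2 h5
  obtain ⟨w, hw, w1, w2⟩ := hU.jump3 hG hc (i := 5) h5 h1
  have hole := hG.hole_mk h1.1.symm w2.symm w1.symm x2.symm x1.symm h2.1 (hc.adj 1).symm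
    (hU.ne_hole hw _).symm (hU.att_ne hG hc h1 h5 (by decide))
    (fun h => hc.common1 hG (i := 1) h1 h2 w2 (h ▸ x1.symm))
    (hU.att_ne hG hc h5 h2 (by decide)) (hU.ne_hole hx _) (hU.att_ne_hole h2 _)
    (hU.att_ne_hole h1 _).symm
  have key : ∀ x' ∈ U, ∀ y, y ∉ U → G.Adj x' y →
      y ∈ Set.range ![c 1, p1, w, p5, x, p2, c 2] := by
    intro x' hx' y hy hxy
    obtain ⟨i, hi⟩ := hU.exists_att hx' hy hxy
    rcases hT y i hi with rfl | rfl | rfl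
    · exact ⟨1, hU.att_unique' hG hc (i := 5) h5 h1 hi⟩
    · exact ⟨5, hU.att_unique hG hc (i := 2) h2 hi h5⟩
    · exact ⟨3, hU.att_unique hG hc (i := 5) h5 hi h1⟩
  exact hmin.false_of_hole hG hdeg hole (fun x' hx' y hy hxy => Or.inl (key x' hx' y hy hxy)) 2 hw
    fun y hy hyw => Or.inl (key w hw y hy hyw.symm)

lemma IsComp.not_least_1235 {p1 p3 p5 : V} (h1 : Att G c U p1 1) (h3 : Att G c U p3 3)
    (h5 : Att G c U p5 5) (hT : ∀ p i, Att G c U p i → i = 1 ∨ i = 2 ∨ i = 3 ∨ i = 5) :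
    False := by
  obtain ⟨w, q, hw, hq, e1, e2, e3, e4⟩ := hU.exists_hub hG hc h1 h3 h5
  have hole := hG.hole_mk (hc.adj 1) (hc.adj 2) h3.1.symm e3 e4 e1.symm h1.1
    (hc.ne (by decide)) (hU.att_ne_hole h3 _).symm (hU.ne_hole hq _).symm
    (hU.ne_att hw h3).symm (hU.ne_att hq h1) (hU.ne_hole hw _) (hU.att_ne_hole h1 _)
  have key : ∀ x ∈ U, ∀ y, y ∉ U → G.Adj x y →
      (∃ k, k ≠ 4 ∧ G.Adj y (![c 1, c 2, c 3, p3, q, w, p1] k)) := by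
    intro x hx y hy hxy
    obtain ⟨i, hi⟩ := hU.exists_att hx hy hxy
    rcases hT y i hi with rfl | rfl | rfl | rfl
    · exact ⟨0, by decide, hi.1⟩
    · exact ⟨1, by decide, hi.1⟩
    · exact ⟨2, by decide, hi.1⟩
    · refine ⟨5, by decide, ?_⟩
      rw [← hU.att_unique hG hc (i := 5) h5 hi h1]
      exact e2
  refine hmin.false_of_hole hG hdeg hole (fun x hx y hy hxy => ?_) 4 hq
    fun y hy hyw => Or.inr (key q hq y hy hyw.symm)
  obtain ⟨k, -, hk⟩ := key x hx y hy hxy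
  exact Or.inr ⟨k, hk⟩

lemma IsComp.not_least_135 {p1 p3 p5 : V} (h1 : Att G c U p1 1) (h3 : Att G c U p3 3)
    (h5 : Att G c U p5 5) : False := by
  have hc' : Hole G fun i => c (-i + 6) := (hc.rot 6).refl
  have hU' : IsComp G (fun i => c (-i + 6)) U := (hU.rot 6).refl
  have h6 : ∀ p, ¬ Att G c U p 6 := fun p h6 => hU.not_att_1356 hG hc h1 h3 h5 h6
  have h0 : ∀ p, ¬ Att G c U p 0 := fun p h0 => hU'.not_att_1356 hG hc' h5 h3 h1 h0
  by_cases h2 : ∃ p, Att G c U p 2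
  · obtain ⟨p2, h2⟩ := h2
    have h4 : ∀ p, ¬ Att G c U p 4 := fun p h4 => hU.not_att_1245 hG hc h1 h2 h4 h5
    refine hU.not_least_1235 hG hc hmin hdeg h1 h3 h5 fun p i hi => ?_
    fin_cases i
    exacts [(h0 p hi).elim, by decide, by decide, by decide, (h4 p hi).elim, by decide,
      (h6 p hi).elim]
  · refine hU'.not_least_1235 hG hc' hmin hdeg h5 h3 h1 fun p i hi => ?_
    fin_cases i
    exacts [(h6 p hi).elim, by decide, by decide, by decide, (h2 ⟨p, hi⟩).elim, by decide,
      (h0 p hi).elim]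

lemma IsComp.exists_local : ∃ k, ∀ p i, Att G c U p i → i = k ∨ i = k + 1 := by
  classical
  have cover : ∀ b0 b1 b2 b3 b4 b5 b6 : Bool, ∃ k : Fin 7,
      let T : Fin 7 → Bool := fun i => ![b0, b1, b2, b3, b4, b5, b6] (i + k)
      (∀ i, T i → i = 0 ∨ i = 1) ∨
      (T 1 ∧ T 4 ∧ ∀ i, T i → i = 1 ∨ i = 2 ∨ i = 3 ∨ i = 4) ∨
      (T 1 ∧ T 3 ∧ ∀ i, T i → i = 1 ∨ i = 2 ∨ i = 3) ∨
      (T 1 ∧ T 2 ∧ T 4 ∧ T 5) ∨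
      (T 1 ∧ T 2 ∧ T 5 ∧ ∀ i, T i → i = 1 ∨ i = 2 ∨ i = 5) ∨
      (T 1 ∧ T 3 ∧ T 5) := by decide
  let P : Fin 7 → Bool := fun i => decide (∃ p, Att G c U p i)
  obtain ⟨k, hk⟩ := cover (P 0) (P 1) (P 2) (P 3) (P 4) (P 5) (P 6)
  have hP : ∀ i, ![P 0, P 1, P 2, P 3, P 4, P 5, P 6] i = P i := by
    intro i; fin_cases i <;> rfl
  have hc' := hc.rot k
  have hU' := hU.rot k
  have hT : ∀ {p i}, Att G (fun i => c (i + k)) U p i → P (i + k) = true :=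
    fun {p i} h => decide_eq_true ⟨p, h⟩
  have hT' : ∀ {i}, P (i + k) = true → ∃ p, Att G (fun i => c (i + k)) U p i :=
    fun h => of_decide_eq_true h
  simp only [hP] at hk
  rcases hk with h | ⟨h1, h4, h⟩ | ⟨h1, h3, h⟩ | ⟨h1, h2, h4, h5⟩ | ⟨h1, h2, h5, h⟩ | ⟨h1, h3, h5⟩
  · refine ⟨k, fun p i hi => ?_⟩
    have := h (i - k) (hT (p := p) (by simpa [Att] using hi))
    simpa [sub_eq_iff_eq_add, add_comm] using this
  · obtain ⟨p, hp⟩ := hT' h1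
    obtain ⟨q, hq⟩ := hT' h4
    exact (hU'.not_least_14 hG hc' hmin hdeg hp hq fun p i hi => h i (hT hi)).elim
  · obtain ⟨p, hp⟩ := hT' h1
    obtain ⟨q, hq⟩ := hT' h3
    exact (hU'.not_least_13 hG hc' hmin hdeg hp hq fun p i hi => h i (hT hi)).elim
  · obtain ⟨p1, h1⟩ := hT' h1
    obtain ⟨p2, h2⟩ := hT' h2
    obtain ⟨p4, h4⟩ := hT' h4
    obtain ⟨p5, h5⟩ := hT' h5
    exact (hU'.not_att_1245 hG hc' h1 h2 h4 h5).elim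
  · obtain ⟨p1, h1⟩ := hT' h1
    obtain ⟨p2, h2⟩ := hT' h2
    obtain ⟨p5, h5⟩ := hT' h5
    exact (hU'.not_least_125 hG hc' hmin hdeg h1 h2 h5 fun p i hi => h i (hT hi)).elim
  · obtain ⟨p1, h1⟩ := hT' h1
    obtain ⟨p3, h3⟩ := hT' h3
    obtain ⟨p5, h5⟩ := hT' h5
    exact (hU'.not_least_135 hG hc' hmin hdeg h1 h3 h5).elim

end

/-- If a component attaches to the 7-cycle at one edge only and is bipartite, then a 3-colouring
of the rest of the graph extends to it after recolouring. -/
lemma IsComp.colorable {c : Fin 7 → V} {U : Set V} (hG : Hep G) (hc : Hole G c)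
    (hU : IsComp G c U) {k : Fin 7} (hT : ∀ p i, Att G c U p i → i = k ∨ i = k + 1)
    (h2 : (G.induce U).Colorable 2) (φ : V → Fin 3)
    (hφ : ∀ x y, x ∉ U → y ∉ U → G.Adj x y → φ x ≠ φ y) : G.Colorable 3 := by
  classical
  obtain ⟨C⟩ := h2
  have huniq : ∀ x ∈ U, ∀ p q, p ∉ U → q ∉ U → G.Adj x p → G.Adj x q → p = q := by
    intro x hx p q hp hq hxp hxq
    obtain ⟨i, hi⟩ := hU.exists_att hx hp hxp
    obtain ⟨j, hj⟩ := hU.exists_att hx hq hxq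
    rcases hT p i hi with rfl | rfl <;> rcases hT q j hj with rfl | rfl
    exacts [hU.eq_of_common hG hx hi hj hxp hxq, (hc.common1 hG hi hj hxp hxq).elim,
      (hc.common1 hG hj hi hxq hxp).elim, hU.eq_of_common hG hx hi hj hxp hxq]
  have hedge : ∀ x ∈ U, ∀ y ∈ U, ∀ p q, p ∉ U → q ∉ U → G.Adj x p → G.Adj y q →
      ¬ G.Adj x y := by
    intro x hx y hy p q hp hq hxp hyq hxy
    obtain ⟨i, hi⟩ := hU.exists_att hx hp hxp
    obtain ⟨j, hj⟩ := hU.exists_att hy hq hyq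
    rcases hT p i hi with rfl | rfl <;> rcases hT q j hj with rfl | rfl
    exacts [hG.no5 hxp hi.1 hj.1.symm hyq.symm hxy.symm, hU.edge1 hG hc hx hy hi hj hxp hyq hxy,
      hU.edge1 hG hc hy hx hj hi hyq hxp hxy.symm, hG.no5 hxp hi.1 hj.1.symm hyq.symm hxy.symm]
  let κ : V → Fin 3 := fun x => if h : x ∈ U then
    if ∃ p, p ∉ U ∧ G.Adj x p ∧ φ p ≠ 0 then 0 else (C ⟨x, h⟩).succ else φ x
  have key : ∀ x ∈ U, ∀ y, y ∉ U → G.Adj x y → κ x ≠ κ y := by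
    intro x hx y hy hxy
    simp only [κ, dif_pos hx, dif_neg hy]
    split_ifs with h
    · obtain ⟨p, hp, hxp, h0⟩ := h
      rw [huniq x hx y p hy hp hxy hxp]
      exact h0.symm
    · have : φ y = 0 := by
        by_contra h0
        exact h ⟨y, hy, hxy, h0⟩
      rw [this]
      exact Fin.succ_ne_zero _
  refine ⟨SimpleGraph.Coloring.mk κ fun {x y} hxy => ?_⟩
  by_cases hx : x ∈ U <;> by_cases hy : y ∈ U
  · simp only [κ, dif_pos hx, dif_pos hy]
    split_ifs with h h' h'
    · obtain ⟨p, hp, hxp, -⟩ := h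
      obtain ⟨q, hq, hyq, -⟩ := h'
      exact absurd hxy (hedge x hx y hy p q hp hq hxp hyq)
    · exact (Fin.succ_ne_zero _).symm
    · exact Fin.succ_ne_zero _
    · exact fun h => C.valid (v := ⟨x, hx⟩) (w := ⟨y, hy⟩) hxy (Fin.succ_injective _ h)
  · exact key x hx y hy hxy
  · exact (key y hy x hx hxy.symm).symm
  · simp only [κ, dif_neg hx, dif_neg hy]
    exact hφ x y hx hy hxy

lemma IsComp.false_of_least {c : Fin 7 → V} {U : Set V} (hG : Hep G) (hU : IsComp G c U)
    (hc : Hole G c) (hmin : Least G U) (hdeg : ∀ v a b, ∃ u, G.Adj v u ∧ u ≠ a ∧ u ≠ b)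
    {l : Fin 7 → V} (hl : Hole G l) (hlU : ∀ i, l i ∈ U) : False := by
  have hcl : ∀ i, c i ∉ nbhd G l := by
    rintro i (⟨j, h⟩ | ⟨j, h⟩)
    · exact hU.ne_hole (hlU j) i h
    · exact hU.far _ (hlU j) (Or.inr ⟨i, h.symm⟩)
  obtain ⟨W, hW, hW0⟩ := exists_isComp l (hcl 0)
  have step : ∀ i, c i ∈ W → c (i + 1) ∈ W := fun i hi => hW.closed _ hi _ (hc.adj i) (hcl _)
  have hcW : ∀ i, c i ∈ W := by
    have h1 := step 0 hW0
    have h2 := step 1 h1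
    have h3 := step 2 h2
    have h4 := step 3 h3
    have h5 := step 4 h4
    have h6 := step 5 h5
    intro i
    fin_cases i
    exacts [hW0, h1, h2, h3, h4, h5, h6]
  have hatt : ∀ i, ∃ p, Att G l W p i := by
    intro i
    obtain ⟨p, x, hpl, -, hpx, hx⟩ := hl.exists_far hG hdeg i
    by_cases hpc : p ∈ nbhd G c
    · rcases hpc with ⟨j, rfl⟩ | ⟨j, hj⟩
      · exact absurd (Or.inr ⟨j, hpl.symm⟩) (hU.far _ (hlU i))
      · exact ⟨p, hpl, _, hcW j, hj⟩
    by_cases hxW : x ∈ W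
    · exact ⟨p, hpl, x, hxW, hpx⟩
    exfalso
    have hpU : p ∈ U := hU.closed _ (hlU i) _ hpl.symm hpc
    obtain ⟨Q, hQ, hxQ⟩ := exists_isComp l hx
    have hQW : ∀ z ∈ Q, z ∉ W := by
      intro z hzQ hzW
      exact hxW (hQ.subset hzQ hzW (fun a ha b hb hab => hW.closed a ha b hab (hQ.far b hb)) hxQ)
    have hQc : ∀ z ∈ Q, z ∉ nbhd G c := by
      rintro z hz (⟨j, rfl⟩ | ⟨j, hj⟩)
      · exact hQW _ hz (hcW j)
      · exact hQW z hz (hW.closed _ (hcW j) _ hj.symm (hQ.far z hz))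
    have hxU : x ∈ U := hU.closed p hpU x hpx (hQc x hxQ)
    have hQU : Q ⊆ U := hQ.subset hxQ hxU fun a ha b hb hab => hU.closed a ha b hab (hQc b hb)
    exact hmin l Q hl hQ ⟨hQU, fun h => hQ.far _ (h (hlU i)) (Or.inl ⟨i, rfl⟩)⟩
  obtain ⟨p1, h1⟩ := hatt 1
  obtain ⟨p2, h2⟩ := hatt 2
  obtain ⟨p4, h4⟩ := hatt 4
  obtain ⟨p5, h5⟩ := hatt 5
  exact hW.not_att_1245 hG hl h1 h2 h4 h5

lemma Hep.colorable_of_proper [Finite V] (hG : Hep G)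
    (h : ∀ W : Set V, W ≠ Set.univ → (G.induce W).Colorable 3) : G.Colorable 3 := by
  classical
  by_contra hcol
  have hext : ∀ W : Set V, W ≠ Set.univ → ∃ φ : V → Fin 3, ∀ x y, x ∈ W → y ∈ W →
      G.Adj x y → φ x ≠ φ y := by
    intro W hW
    obtain ⟨C⟩ := h W hW
    refine ⟨fun x => if hx : x ∈ W then C ⟨x, hx⟩ else 0, fun x y hx hy hxy => ?_⟩
    simp only [dif_pos hx, dif_pos hy]
    exact C.valid (v := ⟨x, hx⟩) (w := ⟨y, hy⟩) hxy
  have hdeg : ∀ v a b, ∃ u, G.Adj v u ∧ u ≠ a ∧ u ≠ b := by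
    intro v a b
    by_contra hcon
    have hcon : ∀ u, G.Adj v u → u = a ∨ u = b := fun u hu => by
      by_contra hn
      exact hcon ⟨u, hu, fun e => hn (Or.inl e), fun e => hn (Or.inr e)⟩
    obtain ⟨φ, hφ⟩ := hext {v}ᶜ (by simp)
    obtain ⟨t, hta, htb⟩ : ∃ t : Fin 3, t ≠ φ a ∧ t ≠ φ b := by
      generalize φ a = i
      generalize φ b = j
      revert i j
      decide
    have hv : ∀ u, G.Adj v u → t ≠ φ u := fun u hu => by
      rcases hcon u hu with rfl | rfl <;> assumption
    refine hcol ⟨SimpleGraph.Coloring.mk (fun x => if x = v then t else φ x) fun {x y} hxy => ?_⟩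
    split_ifs with hx hy hy
    · exact absurd hxy (by rw [hx, hy]; exact G.loopless.irrefl _)
    · exact hv y (hx ▸ hxy)
    · exact (hv x (hy ▸ hxy.symm)).symm
    · exact hφ x y hx hy hxy
  have hhole : ∃ c, Hole G c := by
    have : ¬ (G.induce Set.univ).Colorable 2 := fun h2 =>
      hcol ((h2.mono (by omega)).of_hom (SimpleGraph.induceUnivIso G).symm.toHom)
    obtain ⟨c, hc, -⟩ := hG.exists_hole this
    exact ⟨c, hc⟩
  have hex : ∃ U : Set V, ∃ c, Hole G c ∧ IsComp G c U := by
    obtain ⟨c, hc⟩ := hhole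
    obtain ⟨p, x, -, -, -, hx⟩ := hc.exists_far hG hdeg 0
    obtain ⟨U, hU, -⟩ := exists_isComp c hx
    exact ⟨U, c, hc, hU⟩
  obtain ⟨U, ⟨c, hc, hU⟩, hlt⟩ := WellFounded.has_min (wellFounded_lt (α := Set V))
    {U | ∃ c, Hole G c ∧ IsComp G c U} hex
  have hmin : Least G U := fun c' Q hc' hQ => hlt Q ⟨c', hc', hQ⟩
  obtain ⟨k, hk⟩ := hU.exists_local hG hc hmin hdeg
  by_cases h2 : (G.induce U).Colorable 2
  · obtain ⟨φ, hφ⟩ := hext Uᶜ (by simpa using hU.nonempty.ne_empty)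
    exact hcol (hU.colorable hG hc hk h2 φ fun x y => hφ x y)
  · obtain ⟨l, hl, hlU⟩ := hG.exists_hole h2
    exact hU.false_of_least hG hc hmin hdeg hl hlU

lemma Hep.colorable_three (n : ℕ) : ∀ {V : Type*} [Finite V] {G : SimpleGraph V}, Hep G →
    Nat.card V = n → G.Colorable 3 := by
  induction n using Nat.strong_induction_on with
  | _ n ih =>
    intro V _ G hG hn
    refine hG.colorable_of_proper fun W hW => ih (Nat.card W) ?_ (hG.induce W) rfl
    rw [← hn, ← Nat.card_univ (α := V)]
    exact Set.ncard_lt_ncard (Set.ssubset_univ_iff.2 hW)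

end Heptagraph

theorem heptagraph_colorable_three {V : Type*} [Fintype V] (G : SimpleGraph V)
    (hG : IsHeptagraph G) : G.Colorable 3 :=
  (Heptagraph.hep_of_isHeptagraph hG).colorable_three _ rfl
end

section
/- Let G be a heptagraph, C = c1...c7c1 an induced 7-cycle, P1 an induced path of length 4 from c1 to c4 whose internal vertices lie outside C and have no neighbors on C other than c1 and c4, and P2 an induced path of length 4 from c1 to c5 whose internal vertices lie outside C and have no neighbors on C other than c1 and c5. Then G contains an induced subgraph isomorphic to the graph P' (the 12-cycle 1-2-...-12-1 plus chords {3,9} and {6,12}). -/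
def IsInducedCycle7 {V : Type*} (G : SimpleGraph V) (c : Fin 7 → V) : Prop :=
  Function.Injective c ∧ (∀ i, G.Adj (c i) (c (i + 1))) ∧
    ∀ i j, G.Adj (c i) (c j) → j = i + 1 ∨ i = j + 1

def Pprime : SimpleGraph (Fin 12) :=
  SimpleGraph.fromRel (fun i j => j = i + 1 ∨ (i = 2 ∧ j = 8) ∨ (i = 5 ∧ j = 11))

namespace SimpleGraph

variable {V : Type*} {G : SimpleGraph V}

theorem Walk.exists_support_eq_of_length_eq_four {u v : V} (p : G.Walk u v) (hp : p.length = 4) :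
    ∃ x y z, G.Adj u x ∧ G.Adj x y ∧ G.Adj y z ∧ G.Adj z v ∧ p.support = [u, x, y, z, v] := by
  match p, hp with
  | .cons h₁ (.cons h₂ (.cons h₃ (.cons h₄ .nil))), _ =>
    exact ⟨_, _, _, h₁, h₂, h₃, h₄, by simp⟩

end SimpleGraph

namespace IsHeptagraph

variable {V : Type*} {G : SimpleGraph V}

theorem no_triangle (hG : IsHeptagraph G) {a b c : V}
    (h₁ : G.Adj a b) (h₂ : G.Adj b c) (h₃ : G.Adj c a) : False := by
  have := hG.1 a (.cons h₁ (.cons h₂ (.cons h₃ .nil))) (by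
    simp [SimpleGraph.Walk.cons_isCycle_iff, h₁.ne, h₂.ne, h₃.ne, h₁.ne', h₃.ne'])
  simp at this

theorem no_four_cycle (hG : IsHeptagraph G) {a b c d : V}
    (h₁ : G.Adj a b) (h₂ : G.Adj b c) (h₃ : G.Adj c d) (h₄ : G.Adj d a)
    (hac : a ≠ c) (hbd : b ≠ d) : False := by
  have := hG.1 a (.cons h₁ (.cons h₂ (.cons h₃ (.cons h₄ .nil)))) (by
    simp [SimpleGraph.Walk.cons_isCycle_iff, h₁.ne, h₂.ne, h₃.ne, h₄.ne, h₁.ne', h₄.ne',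
      hac, hac.symm, hbd])
  simp at this

/-- There is no closed walk of length five: a degenerate one would contain a triangle. -/
theorem no_five_cycle (hG : IsHeptagraph G) {a b c d e : V}
    (h₁ : G.Adj a b) (h₂ : G.Adj b c) (h₃ : G.Adj c d) (h₄ : G.Adj d e) (h₅ : G.Adj e a) :
    False := by
  have hac : a ≠ c := by rintro rfl; exact hG.no_triangle h₃ h₄ h₅
  have hbd : b ≠ d := by rintro rfl; exact hG.no_triangle h₄ h₅ h₁
  have hce : c ≠ e := by rintro rfl; exact hG.no_triangle h₅ h₁ h₂
  have hda : d ≠ a := by rintro rfl; exact hG.no_triangle h₁ h₂ h₃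
  have heb : e ≠ b := by rintro rfl; exact hG.no_triangle h₂ h₃ h₄
  have := hG.1 a (.cons h₁ (.cons h₂ (.cons h₃ (.cons h₄ (.cons h₅ .nil))))) (by
    simp [SimpleGraph.Walk.cons_isCycle_iff, h₁.ne, h₂.ne, h₃.ne, h₄.ne, h₅.ne, h₁.ne', h₅.ne',
      hac, hac.symm, hbd, hce, hda, hda.symm, heb.symm])
  simp at this

theorem no_induced_nine_cycle (hG : IsHeptagraph G) {f : Fin 9 → V} (hf : Function.Injective f)
    (hadj : ∀ i, G.Adj (f i) (f (i + 1)))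
    (hind : ∀ i j, G.Adj (f i) (f j) → j = i + 1 ∨ i = j + 1) : False := by
  let w : G.Walk (f 0) (f 0) := .cons (hadj 0) (.cons (hadj 1) (.cons (hadj 2) (.cons (hadj 3)
    (.cons (hadj 4) (.cons (hadj 5) (.cons (hadj 6) (.cons (hadj 7) (.cons (hadj 8) .nil))))))))
  have hsupp : w.support = (List.finRange 9).map f ++ [f 0] := rfl
  have hedges : w.edges = (List.finRange 9).map fun i => s(f i, f (i + 1)) := rfl
  have hsub (i : Fin 9) : w.toSubgraph.Adj (f i) (f (i + 1)) := by
    rw [SimpleGraph.Walk.adj_toSubgraph_iff_mem_edges, hedges]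
    exact List.mem_map_of_mem (List.mem_finRange i)
  have hmem : ∀ x ∈ w.toSubgraph.verts, ∃ i, f i = x := by
    intro x hx
    rw [SimpleGraph.Walk.mem_verts_toSubgraph, hsupp] at hx
    simp only [List.mem_append, List.mem_map, List.mem_singleton] at hx
    obtain ⟨i, -, rfl⟩ | rfl := hx
    exacts [⟨i, rfl⟩, ⟨0, rfl⟩]
  have hlen : w.length = 9 := rfl
  have hcycle : w.IsCycle := by
    simp [w, SimpleGraph.Walk.cons_isCycle_iff, hf.eq_iff]
  refine absurd (hG.2 (f 0) w hcycle ?_ (by rw [hlen]; decide)) (by omega)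
  intro x hx y hy hxy
  obtain ⟨i, rfl⟩ := hmem x hx
  obtain ⟨j, rfl⟩ := hmem y hy
  obtain rfl | rfl := hind i j hxy
  · exact hsub i
  · exact (hsub j).symm

end IsHeptagraph

set_option maxHeartbeats 2000000 in
theorem two_short_e_jumps_give_Pprime {V : Type*} (G : SimpleGraph V)
    (hG : IsHeptagraph G) (c : Fin 7 → V) (hc : IsInducedCycle7 G c)
    (P1 : G.Walk (c 0) (c 3)) (hP1 : P1.IsPath) (hP1ind : P1.toSubgraph.IsInduced)
    (hP1len : P1.length = 4)
    (hint1 : ∀ x ∈ P1.support, x ≠ c 0 → x ≠ c 3 →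
      (∀ i : Fin 7, c i ≠ x) ∧
      (∀ i : Fin 7, i ≠ 0 → i ≠ 3 → ¬ G.Adj (c i) x))
    (P2 : G.Walk (c 0) (c 4)) (hP2 : P2.IsPath) (hP2ind : P2.toSubgraph.IsInduced)
    (hP2len : P2.length = 4)
    (hint2 : ∀ x ∈ P2.support, x ≠ c 0 → x ≠ c 4 →
      (∀ i : Fin 7, c i ≠ x) ∧
      (∀ i : Fin 7, i ≠ 0 → i ≠ 4 → ¬ G.Adj (c i) x)) :
    Nonempty (Pprime ↪g G) := by
  obtain ⟨hinj, hcadj, hcind⟩ := hc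
  have hcc (i j : Fin 7) : G.Adj (c i) (c j) ↔ j = i + 1 ∨ i = j + 1 :=
    ⟨hcind i j, by rintro (rfl | rfl); exacts [hcadj i, (hcadj j).symm]⟩
  have h34 : G.Adj (c 3) (c 4) := hcadj 3
  obtain ⟨a₁, a₂, a₃, ha₁, ha₂, ha₃, ha₄, hs₁⟩ := P1.exists_support_eq_of_length_eq_four hP1len
  obtain ⟨b₁, b₂, b₃, hb₁, hb₂, hb₃, hb₄, hs₂⟩ := P2.exists_support_eq_of_length_eq_four hP2len
  have hn₁ := hP1.support_nodup
  have hn₂ := hP2.support_nodup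
  rw [hs₁] at hn₁ hint1
  rw [hs₂] at hn₂ hint2
  simp only [List.nodup_cons, List.mem_cons, List.not_mem_nil, or_false, not_or, not_false_eq_true,
    List.nodup_nil, and_true] at hn₁ hn₂
  obtain ⟨⟨n₁, n₂, n₃, n₄⟩, ⟨n₅, n₆, n₇⟩, ⟨n₈, n₉⟩, n₁₀⟩ := hn₁
  obtain ⟨⟨m₁, m₂, m₃, m₄⟩, ⟨m₅, m₆, m₇⟩, ⟨m₈, m₉⟩, m₁₀⟩ := hn₂
  obtain ⟨ca₁, xa₁⟩ := hint1 a₁ (by simp) (Ne.symm n₁) n₇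
  obtain ⟨ca₂, xa₂⟩ := hint1 a₂ (by simp) (Ne.symm n₂) n₉
  obtain ⟨ca₃, xa₃⟩ := hint1 a₃ (by simp) (Ne.symm n₃) n₁₀
  obtain ⟨cb₁, xb₁⟩ := hint2 b₁ (by simp) (Ne.symm m₁) m₇
  obtain ⟨cb₂, xb₂⟩ := hint2 b₂ (by simp) (Ne.symm m₂) m₉
  obtain ⟨cb₃, xb₃⟩ := hint2 b₃ (by simp) (Ne.symm m₃) m₁₀
  have t {a b c : V} := hG.no_triangle (a := a) (b := b) (c := c)
  have q {a b c d : V} := hG.no_four_cycle (a := a) (b := b) (c := c) (d := d)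
  have p {a b c d e : V} := hG.no_five_cycle (a := a) (b := b) (c := c) (d := d) (e := e)
  -- adjacencies between the paths and `C`
  have Ca₁ (i : Fin 7) : G.Adj (c i) a₁ ↔ i = 0 := by
    refine ⟨fun h => ?_, by rintro rfl; exact ha₁⟩
    by_contra h0
    by_cases h3 : i = 3
    · subst h3; exact q h ha₂ ha₃ ha₄ (Ne.symm n₉) n₆
    · exact xa₁ i h0 h3 h
  have Ca₂ (i : Fin 7) : ¬ G.Adj (c i) a₂ := by
    intro h
    by_cases h0 : i = 0
    · subst h0; exact t ha₁ ha₂ h.symm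
    by_cases h3 : i = 3
    · subst h3; exact t h ha₃ ha₄
    exact xa₂ i h0 h3 h
  have Ca₃ (i : Fin 7) : G.Adj (c i) a₃ ↔ i = 3 := by
    refine ⟨fun h => ?_, by rintro rfl; exact ha₄.symm⟩
    by_contra h3
    by_cases h0 : i = 0
    · subst h0; exact q ha₁ ha₂ ha₃ h.symm n₂ n₆
    · exact xa₃ i h0 h3 h
  have Cb₁ (i : Fin 7) : G.Adj (c i) b₁ ↔ i = 0 := by
    refine ⟨fun h => ?_, by rintro rfl; exact hb₁⟩
    by_contra h0
    by_cases h3 : i = 4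
    · subst h3; exact q h hb₂ hb₃ hb₄ (Ne.symm m₉) m₆
    · exact xb₁ i h0 h3 h
  have Cb₂ (i : Fin 7) : ¬ G.Adj (c i) b₂ := by
    intro h
    by_cases h0 : i = 0
    · subst h0; exact t hb₁ hb₂ h.symm
    by_cases h3 : i = 4
    · subst h3; exact t h hb₃ hb₄
    exact xb₂ i h0 h3 h
  have Cb₃ (i : Fin 7) : G.Adj (c i) b₃ ↔ i = 4 := by
    refine ⟨fun h => ?_, by rintro rfl; exact hb₄.symm⟩
    by_contra h3
    by_cases h0 : i = 0
    · subst h0; exact q hb₁ hb₂ hb₃ h.symm m₂ m₆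
    · exact xb₃ i h0 h3 h
  have a13 : ¬ G.Adj a₁ a₃ := fun h => t ha₂ ha₃ h.symm
  have b13 : ¬ G.Adj b₁ b₃ := fun h => t hb₂ hb₃ h.symm
  -- coincidences between the two paths that a short cycle rules out
  have e33 : a₃ ≠ b₃ := by rintro rfl; exact t ha₄ h34 hb₄.symm
  have e12 : a₁ ≠ b₂ := by rintro rfl; exact Cb₂ 0 ha₁
  have e13 : a₁ ≠ b₃ := by rintro rfl; simpa using (Cb₃ 0).1 ha₁
  have e21 : a₂ ≠ b₁ := by rintro rfl; exact Ca₂ 0 hb₁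
  have e23 : a₂ ≠ b₃ := by rintro rfl; exact Ca₂ 4 hb₄.symm
  have e31 : a₃ ≠ b₁ := by rintro rfl; simpa using (Ca₃ 0).1 hb₁
  have e32 : a₃ ≠ b₂ := by rintro rfl; exact Cb₂ 3 ha₄.symm
  have e22 : a₂ ≠ b₂ := by rintro rfl; exact p ha₃ ha₄ h34 hb₄.symm hb₃.symm
  have d23 : ¬ G.Adj a₂ b₃ := fun h => p ha₃ ha₄ h34 hb₄.symm h.symm
  have d32 : ¬ G.Adj a₃ b₂ := fun h => p ha₄ h34 hb₄.symm hb₃.symm h.symm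
  have d33 : ¬ G.Adj a₃ b₃ := fun h => q ha₄ h34 hb₄.symm h.symm (ca₃ 4).symm (cb₃ 3)
  have Sa₁ (i : Fin 7) : G.Adj a₁ (c i) ↔ i = 0 := by rw [G.adj_comm, Ca₁]
  have Sa₂ (i : Fin 7) : ¬ G.Adj a₂ (c i) := by rw [G.adj_comm]; exact Ca₂ i
  have Sa₃ (i : Fin 7) : G.Adj a₃ (c i) ↔ i = 3 := by rw [G.adj_comm, Ca₃]
  have Sb₁ (i : Fin 7) : G.Adj b₁ (c i) ↔ i = 0 := by rw [G.adj_comm, Cb₁]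
  have Sb₂ (i : Fin 7) : ¬ G.Adj b₂ (c i) := by rw [G.adj_comm]; exact Cb₂ i
  have Sb₃ (i : Fin 7) : G.Adj b₃ (c i) ↔ i = 4 := by rw [G.adj_comm, Cb₃]
  by_cases e11 : a₁ = b₁
  · subst e11
    have d22 : ¬ G.Adj a₂ b₂ := fun h => t ha₂ h hb₂.symm
    let f : Fin 12 → V :=
      ![c 1, c 2, c 3, a₃, a₂, a₁, b₂, b₃, c 4, c 5, c 6, c 0]
    have hf : Function.Injective f := by
      intro i j
      fin_cases i <;> fin_cases j <;> simp [f, hinj.eq_iff,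
        ca₁, ca₂, ca₃, cb₂, cb₃, (ca₁ _).symm, (ca₂ _).symm,
        (ca₃ _).symm, (cb₂ _).symm, (cb₃ _).symm] <;> grind only
    refine ⟨⟨⟨f, hf⟩, ?_⟩⟩
    intro i j
    fin_cases i <;> fin_cases j <;> simp [f, Pprime, hcc, Ca₁, Ca₂, Ca₃, Cb₂, Cb₃, Sa₁, Sa₂, Sa₃,
      Sb₂, Sb₃] <;> grind only [SimpleGraph.adj_comm]
  · exfalso
    have d11 : ¬ G.Adj a₁ b₁ := fun h => t ha₁ h hb₁.symm
    have d12 : ¬ G.Adj a₁ b₂ := fun h => q ha₁ h hb₂.symm hb₁.symm m₂ e11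
    have d21 : ¬ G.Adj a₂ b₁ := fun h => q ha₁ ha₂ h hb₁.symm n₂ e11
    have d13 : ¬ G.Adj a₁ b₃ := fun h => p ha₁ h hb₃.symm hb₂.symm hb₁.symm
    have d31 : ¬ G.Adj a₃ b₁ := fun h => p ha₁ ha₂ ha₃ h hb₁.symm
    have d22 : ¬ G.Adj a₂ b₂ := fun h => p ha₁ ha₂ h hb₂.symm hb₁.symm
    let f : Fin 9 → V := ![c 0, a₁, a₂, a₃, c 3, c 4, b₃, b₂, b₁]
    have hf : Function.Injective f := by
      intro i j
      fin_cases i <;> fin_cases j <;> simp [f, hinj.eq_iff,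
        ca₁, ca₂, ca₃, cb₁, cb₂, cb₃, (ca₁ _).symm, (ca₂ _).symm,
        (ca₃ _).symm, (cb₁ _).symm, (cb₂ _).symm, (cb₃ _).symm] <;> grind only
    refine hG.no_induced_nine_cycle hf ?_ ?_
    · intro i
      fin_cases i <;> simp [f, hcc] <;>
        first | assumption | exact SimpleGraph.Adj.symm (by assumption)
    · intro i j
      fin_cases i <;> fin_cases j <;> simp [f, hcc, Ca₁, Ca₂, Ca₃, Cb₁, Cb₂, Cb₃, Sa₁, Sa₂, Sa₃,
        Sb₁, Sb₂, Sb₃] <;> grind only [SimpleGraph.adj_comm]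
end
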